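/- There is no nontrivial 2-(v,k,λ) design D with a flag-transitive group G of automorphisms satisfying Hypothesis (H) whose parameter tuple (λ, v, k, c, d, ℓ) equals one of (3, 256, 18, 16, 16, 2), (4, 231, 24, 21, 11, 3), or (4, 484, 24, 22, 22, 2). -/

import Mathlib

open MulAction

namespace FlagTransitive

open scoped Classical in
/-- A flag-transitive action of `G` on a `2`-design with points `Ω` and blocks `𝔅`, preserving a
partition of the points (given by the class map `cl : Ω → C`) such that every block meets every
class in `0` or `ℓ` points. -/
structure ImprimitiveDesign (G : Type*) {Ω C 𝔅 : Type*} [Group G] [Fintype Ω] [Fintype C]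
    [Fintype 𝔅] [MulAction G Ω] [MulAction G C] [MulAction G 𝔅] (cl : Ω → C)
    (inc : Ω → 𝔅 → Prop) (lam v k c d ℓ : ℕ) : Prop where
  cl_smul : ∀ (g : G) α, cl (g • α) = g • cl α
  inc_smul : ∀ (g : G) {α B}, inc α B → inc (g • α) (g • B)
  faithful : ∀ g : G, (∀ α : Ω, g • α = α) → g = 1
  flag : ∀ {α β B D}, inc α B → inc β D → ∃ g : G, g • α = β ∧ g • B = D
  card_point : Fintype.card Ω = v
  card_class : Fintype.card C = d
  card_fiber : ∀ Δ, (Finset.univ.filter fun α => cl α = Δ).card = c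
  card_block : ∀ B, (Finset.univ.filter fun α => inc α B).card = k
  card_pair : ∀ {α β}, α ≠ β → (Finset.univ.filter fun B => inc α B ∧ inc β B).card = lam
  card_inter : ∀ {α B}, inc α B →
    (Finset.univ.filter fun β => inc β B ∧ cl β = cl α).card = ℓ

namespace ImprimitiveDesign

section

open scoped Classical

variable {G Ω C 𝔅 : Type*} [Group G] [Fintype Ω] [Fintype C]
    [Fintype 𝔅] [MulAction G Ω] [MulAction G C] [MulAction G 𝔅] {cl : Ω → C}
    {inc : Ω → 𝔅 → Prop} {lam v k c d ℓ : ℕ}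

/-- The set of classes met by a block. -/
noncomputable def supp (cl : Ω → C) (inc : Ω → 𝔅 → Prop) (B : 𝔅) : Finset C :=
  Finset.univ.filter fun Δ => ∃ α, inc α B ∧ cl α = Δ

theorem mem_supp {B : 𝔅} {Δ : C} : Δ ∈ supp cl inc B ↔ ∃ α, inc α B ∧ cl α = Δ := by
  simp [supp]

theorem inc_smul_iff (H : ImprimitiveDesign G cl inc lam v k c d ℓ)
    (g : G) {α : Ω} {B : 𝔅} : inc (g • α) (g • B) ↔ inc α B :=
  ⟨fun h => by simpa using H.inc_smul g⁻¹ h, H.inc_smul g⟩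

theorem smul_mem_supp (H : ImprimitiveDesign G cl inc lam v k c d ℓ) (g : G) {Δ : C} {B : 𝔅} :
    g • Δ ∈ supp cl inc (g • B) ↔ Δ ∈ supp cl inc B := by
  have key : ∀ (g : G) {Δ : C} {B : 𝔅}, Δ ∈ supp cl inc B → g • Δ ∈ supp cl inc (g • B) := by
    intro g Δ B h
    obtain ⟨α, h1, rfl⟩ := mem_supp.1 h
    exact mem_supp.2 ⟨g • α, H.inc_smul g h1, H.cl_smul g α⟩
  exact ⟨fun h => by simpa using key g⁻¹ h, key g⟩

theorem card_inter_of_mem_supp (H : ImprimitiveDesign G cl inc lam v k c d ℓ)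
    {B : 𝔅} {Δ : C} (h : Δ ∈ supp cl inc B) :
    (Finset.univ.filter fun β => inc β B ∧ cl β = Δ).card = ℓ := by
  obtain ⟨α, h1, rfl⟩ := mem_supp.1 h
  exact H.card_inter h1

theorem card_through (H : ImprimitiveDesign G cl inc lam v k c d ℓ) (α : Ω) :
    (Finset.univ.filter fun B => inc α B).card * (k - 1) = (v - 1) * lam := by
  have := Finset.card_mul_eq_card_mul (s := Finset.univ.filter fun B => inc α B)
    (t := Finset.univ.erase α) (fun B β => inc β B) (m := k - 1) (n := lam) ?_ ?_
  · rwa [Finset.card_erase_of_mem (Finset.mem_univ _), Finset.card_univ, H.card_point] at this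
  · intro B hB
    rw [Finset.mem_filter] at hB
    rw [← H.card_block B, ← Finset.card_erase_of_mem (a := α) (by simpa using hB)]
    congr 1
    ext β
    simp [Finset.mem_bipartiteAbove]
  · intro β hβ
    rw [← H.card_pair (α := α) (β := β) (by simpa [eq_comm] using hβ)]
    congr 1
    ext B
    simp [Finset.mem_bipartiteBelow]

theorem card_blocks (H : ImprimitiveDesign G cl inc lam v k c d ℓ)
    {r : ℕ} (hr : ∀ α, (Finset.univ.filter fun B => inc α B).card = r) :
    Fintype.card 𝔅 * k = v * r := by
  rw [← H.card_point]
  refine Finset.card_mul_eq_card_mul (fun B α => inc α B) ?_ ?_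
  · exact fun B _ => H.card_block B
  · exact fun α _ => hr α

theorem card_supp (H : ImprimitiveDesign G cl inc lam v k c d ℓ)
    (B : 𝔅) : (supp cl inc B).card * ℓ = k := by
  have := Finset.card_mul_eq_card_mul (s := supp cl inc B)
    (t := Finset.univ.filter fun α => inc α B) (fun Δ α => cl α = Δ) (m := ℓ) (n := 1) ?_ ?_
  · rwa [H.card_block, mul_one] at this
  · intro Δ hΔ
    rw [← H.card_inter_of_mem_supp hΔ]
    congr 1
    ext
    simp [Finset.mem_bipartiteAbove]
  · intro α hα
    rw [Finset.card_eq_one]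
    refine ⟨cl α, ?_⟩
    ext Δ
    simp only [Finset.mem_bipartiteBelow, Finset.mem_singleton]
    constructor
    · exact fun h => h.2.symm
    · rintro rfl
      exact ⟨mem_supp.2 ⟨α, by simpa using hα, rfl⟩, rfl⟩

/-- Double counting of the incident pairs between a set of blocks and the points of a class. -/
theorem card_filter_mem_supp (H : ImprimitiveDesign G cl inc lam v k c d ℓ)
    (p : 𝔅 → Prop) (Δ : C) {m : ℕ}
    (hm : ∀ α, cl α = Δ → (Finset.univ.filter fun B => p B ∧ inc α B).card = m) :
    (Finset.univ.filter fun B => p B ∧ Δ ∈ supp cl inc B).card * ℓ = c * m := by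
  rw [← H.card_fiber Δ]
  refine Finset.card_mul_eq_card_mul (fun B α => inc α B) ?_ ?_
  · intro B hB
    rw [← H.card_inter_of_mem_supp (B := B) (Δ := Δ) (by simpa using (Finset.mem_filter.1 hB).2.2)]
    congr 1
    ext
    simp [Finset.mem_bipartiteAbove, and_comm]
  · intro α hα
    rw [← hm α (by simpa using hα)]
    congr 1
    ext B
    simp only [Finset.mem_bipartiteBelow, Finset.mem_filter, Finset.mem_univ, true_and]
    have : cl α = Δ := by simpa using hα
    exact ⟨fun h => ⟨h.1.1, h.2⟩, fun h => ⟨⟨h.1, mem_supp.2 ⟨α, h.2, this⟩⟩, h.2⟩⟩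

theorem card_through_mem_supp (H : ImprimitiveDesign G cl inc lam v k c d ℓ)
    {α : Ω} {Δ : C} (h : Δ ≠ cl α) :
    (Finset.univ.filter fun B => inc α B ∧ Δ ∈ supp cl inc B).card * ℓ = c * lam := by
  refine H.card_filter_mem_supp (fun B => inc α B) Δ fun β hβ => H.card_pair ?_
  rintro rfl
  exact h hβ.symm

theorem card_mem_supp (H : ImprimitiveDesign G cl inc lam v k c d ℓ)
    {r : ℕ} (hr : ∀ α, (Finset.univ.filter fun B => inc α B).card = r) (Δ : C) :
    (Finset.univ.filter fun B => Δ ∈ supp cl inc B).card * ℓ = c * r := by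
  have := H.card_filter_mem_supp (fun _ => True) Δ (m := r) fun β _ => by simpa using hr β
  simpa using this

theorem card_mem_supp_mem_supp (H : ImprimitiveDesign G cl inc lam v k c d ℓ)
    {x : ℕ} {Δ Δ' : C} (hx : ∀ α, cl α = Δ' →
    (Finset.univ.filter fun B => inc α B ∧ Δ ∈ supp cl inc B).card = x) :
    (Finset.univ.filter fun B => Δ ∈ supp cl inc B ∧ Δ' ∈ supp cl inc B).card * ℓ = c * x := by
  convert H.card_filter_mem_supp (fun B => Δ ∈ supp cl inc B) Δ' (m := x) fun β hβ => ?_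
  rw [← hx β hβ]
  congr 1
  ext
  simp [and_comm]

/-- If a set of classes is invariant under the stabilizer of `α`, then the number of blocks
through `α` divides the number of incident pairs of such a block and a class in the set. -/
theorem dvd_card_classes (H : ImprimitiveDesign G cl inc lam v k c d ℓ) (α : Ω) (S : Finset C)
    (hS : ∀ g : G, g • α = α → ∀ Δ ∈ S, g • Δ ∈ S)
    {r x : ℕ} (hr : (Finset.univ.filter fun B => inc α B).card = r)
    (hx : ∀ Δ ∈ S, (Finset.univ.filter fun B => inc α B ∧ Δ ∈ supp cl inc B).card = x) :
    r ∣ S.card * x := by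
  by_cases hB : ∃ B, inc α B
  · obtain ⟨B₀, hB₀⟩ := hB
    refine ⟨(S.filter fun Δ => Δ ∈ supp cl inc B₀).card, ?_⟩
    rw [← hr]
    symm
    refine Finset.card_mul_eq_card_mul (fun B Δ => Δ ∈ supp cl inc B) ?_ ?_
    · intro B hB
      obtain ⟨g, h1, h2⟩ := H.flag hB₀ (show inc α B by simpa using hB)
      symm
      have h3 : g⁻¹ • α = α := by rw [inv_smul_eq_iff, h1]
      refine Finset.card_bij (fun Δ _ => g • Δ) ?_ ?_ ?_
      · intro Δ hΔ
        rw [Finset.mem_filter] at hΔ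
        rw [Finset.mem_bipartiteAbove, ← h2, H.smul_mem_supp]
        exact ⟨hS g h1 _ hΔ.1, hΔ.2⟩
      · intro a _ b _ h
        simpa using h
      · intro Δ hΔ
        rw [Finset.mem_bipartiteAbove] at hΔ
        refine ⟨g⁻¹ • Δ, ?_, by simp⟩
        rw [Finset.mem_filter, ← H.smul_mem_supp g, h2]
        exact ⟨hS _ h3 _ hΔ.1, by simpa using hΔ.2⟩
    · intro Δ hΔ
      rw [← hx Δ hΔ]
      congr 1
      ext
      simp [Finset.mem_bipartiteBelow]
  · rcases S.eq_empty_or_nonempty with rfl | ⟨Δ, hΔ⟩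
    · simp
    · have h0 : x = 0 := by
        rw [← hx Δ hΔ, Finset.card_eq_zero, Finset.filter_eq_empty_iff]
        exact fun B _ h => hB ⟨B, h.1⟩
      simp [h0]

theorem dvd_card_points (H : ImprimitiveDesign G cl inc lam v k c d ℓ)
    (α : Ω) (S : Finset Ω) (hS : ∀ g : G, g • α = α → ∀ β ∈ S, g • β ∈ S)
    {r : ℕ} (hr : (Finset.univ.filter fun B => inc α B).card = r) (hα : α ∉ S) :
    r ∣ S.card * lam := by
  by_cases hB : ∃ B, inc α B
  · obtain ⟨B₀, hB₀⟩ := hB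
    refine ⟨(S.filter fun β => inc β B₀).card, ?_⟩
    rw [← hr]
    symm
    refine Finset.card_mul_eq_card_mul (fun B β => inc β B) ?_ ?_
    · intro B hB
      obtain ⟨g, h1, h2⟩ := H.flag hB₀ (show inc α B by simpa using hB)
      symm
      have h3 : g⁻¹ • α = α := by rw [inv_smul_eq_iff, h1]
      refine Finset.card_bij (fun Δ _ => g • Δ) ?_ ?_ ?_
      · intro Δ hΔ
        rw [Finset.mem_filter] at hΔ
        rw [Finset.mem_bipartiteAbove, ← h2, H.inc_smul_iff]
        exact ⟨hS g h1 _ hΔ.1, hΔ.2⟩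
      · intro a _ b _ h
        simpa using h
      · intro Δ hΔ
        rw [Finset.mem_bipartiteAbove] at hΔ
        refine ⟨g⁻¹ • Δ, ?_, by simp⟩
        rw [Finset.mem_filter, ← H.inc_smul_iff g, h2]
        exact ⟨hS _ h3 _ hΔ.1, by simpa using hΔ.2⟩
    · intro β hβ
      rw [← H.card_pair (α := α) (β := β) (by rintro rfl; exact hα hβ)]
      congr 1
      ext
      simp [Finset.mem_bipartiteBelow]
  · rcases S.eq_empty_or_nonempty with rfl | ⟨β, hβ⟩
    · simp
    · have h0 : lam = 0 := by
        rw [← H.card_pair (α := α) (β := β) (by rintro rfl; exact hα hβ), Finset.card_eq_zero,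
          Finset.filter_eq_empty_iff]
        exact fun B _ h => hB ⟨B, h.1⟩
      simp [h0]

end

section

open scoped Classical

variable {G Ω C 𝔅 : Type*} [Group G] [Fintype Ω] [Fintype C]
    [Fintype 𝔅] [MulAction G Ω] [MulAction G C] [MulAction G 𝔅] {cl : Ω → C}
    {inc : Ω → 𝔅 → Prop} {lam v k c d ℓ : ℕ}

theorem exists_inc (H : ImprimitiveDesign G cl inc lam v k c d ℓ)
    {r : ℕ} (hr : ∀ α, (Finset.univ.filter fun B => inc α B).card = r)
    (hr0 : 0 < r) (α : Ω) : ∃ B, inc α B := by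
  rw [← hr α, Finset.card_pos] at hr0
  obtain ⟨B, hB⟩ := hr0
  exact ⟨B, by simpa using hB⟩

theorem exists_mem_fiber (H : ImprimitiveDesign G cl inc lam v k c d ℓ)
    (hc : 0 < c) (Δ : C) : ∃ α, cl α = Δ := by
  rw [← H.card_fiber Δ, Finset.card_pos] at hc
  obtain ⟨α, hα⟩ := hc
  exact ⟨α, by simpa using hα⟩

theorem exists_smul_point (H : ImprimitiveDesign G cl inc lam v k c d ℓ)
    {r : ℕ} (hr : ∀ α, (Finset.univ.filter fun B => inc α B).card = r)
    (hr0 : 0 < r) (α β : Ω) : ∃ g : G, g • α = β := by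
  obtain ⟨B, hB⟩ := H.exists_inc hr hr0 α
  obtain ⟨D, hD⟩ := H.exists_inc hr hr0 β
  obtain ⟨g, h, -⟩ := H.flag hB hD
  exact ⟨g, h⟩

theorem exists_smul_block (H : ImprimitiveDesign G cl inc lam v k c d ℓ)
    (hk : 0 < k) (B D : 𝔅) : ∃ g : G, g • B = D := by
  have key : ∀ B, ∃ α, inc α B := by
    intro B
    rw [← H.card_block B, Finset.card_pos] at hk
    obtain ⟨α, hα⟩ := hk
    exact ⟨α, by simpa using hα⟩
  obtain ⟨α, hα⟩ := key B
  obtain ⟨β, hβ⟩ := key D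
  obtain ⟨g, -, h⟩ := H.flag hα hβ
  exact ⟨g, h⟩

/-- The stabilizer of a point is transitive on the other classes. -/
theorem exists_smul_class (H : ImprimitiveDesign G cl inc lam v k c d ℓ)
    {r x : ℕ} (hr : ∀ α, (Finset.univ.filter fun B => inc α B).card = r)
    (hx : ∀ α Δ, Δ ≠ cl α →
      (Finset.univ.filter fun B => inc α B ∧ Δ ∈ supp cl inc B).card = x)
    (hdiv : ∀ n, r ∣ n * x → 0 < n → n ≤ d - 1 → n = d - 1)
    {α : Ω} {Δ Δ' : C} (h : Δ ≠ cl α) (h' : Δ' ≠ cl α) : ∃ g : G, g • α = α ∧ g • Δ = Δ' := by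
  set S : Finset C := Finset.univ.filter fun Δ' => ∃ g : G, g • α = α ∧ g • Δ = Δ' with hS
  have hsub : S ⊆ Finset.univ.erase (cl α) := by
    intro Δ₁ h1
    obtain ⟨g, h2, h3⟩ := (Finset.mem_filter.1 h1).2
    refine Finset.mem_erase.2 ⟨?_, Finset.mem_univ _⟩
    rintro rfl
    apply h
    rw [← h2, H.cl_smul, smul_left_cancel_iff] at h3
    exact h3
  have hcard : (Finset.univ.erase (cl α)).card = d - 1 := by
    rw [Finset.card_erase_of_mem (Finset.mem_univ _), Finset.card_univ, H.card_class]
  have hd := H.dvd_card_classes α S (x := x) ?_ (hr α) ?_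
  · have h1 : S.card = d - 1 := by
      refine hdiv _ hd ?_ (hcard ▸ Finset.card_le_card hsub)
      exact Finset.card_pos.2 ⟨Δ, Finset.mem_filter.2 ⟨Finset.mem_univ _, 1, by simp⟩⟩
    have h2 := Finset.eq_of_subset_of_card_le hsub (by rw [hcard, h1])
    have h3 : Δ' ∈ S := by
      rw [h2]
      simpa using h'
    exact (Finset.mem_filter.1 h3).2
  · intro g hg Δ₁ h1
    obtain ⟨g', h2, rfl⟩ := (Finset.mem_filter.1 h1).2
    refine Finset.mem_filter.2 ⟨Finset.mem_univ _, g * g', ?_, mul_smul _ _ _⟩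
    rw [mul_smul, h2, hg]
  · intro Δ₁ h1
    exact hx α Δ₁ (Finset.mem_erase.1 (hsub h1)).1

/-- The stabilizer of a point is transitive on the other points of its class. -/
theorem exists_smul_mem_fiber (H : ImprimitiveDesign G cl inc lam v k c d ℓ) {r : ℕ}
    (hr : ∀ α, (Finset.univ.filter fun B => inc α B).card = r)
    (hdiv : ∀ n, r ∣ n * lam → 0 < n → n ≤ c - 1 → n = c - 1)
    {α β γ : Ω} (hβ : cl β = cl α) (hβα : β ≠ α) (hγ : cl γ = cl α) (hγα : γ ≠ α) :
    ∃ g : G, g • α = α ∧ g • β = γ := by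
  set S : Finset Ω := Finset.univ.filter fun γ => ∃ g : G, g • α = α ∧ g • β = γ with hS
  set T : Finset Ω := (Finset.univ.filter fun γ => cl γ = cl α).erase α with hT
  have hsub : S ⊆ T := by
    intro γ h1
    obtain ⟨g, h2, h3⟩ := (Finset.mem_filter.1 h1).2
    simp only [hT, Finset.mem_erase, Finset.mem_filter, Finset.mem_univ, true_and]
    refine ⟨?_, ?_⟩
    · rintro rfl
      apply hβα
      exact smul_left_cancel g (h3.trans h2.symm)
    · rw [← h3, H.cl_smul, hβ, ← H.cl_smul, h2]
  have hcard : T.card = c - 1 := by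
    rw [Finset.card_erase_of_mem (by simp), H.card_fiber]
  have hd := H.dvd_card_points α S ?_ (hr α) ?_
  · have h1 : S.card = c - 1 := by
      refine hdiv _ hd ?_ (hcard ▸ Finset.card_le_card hsub)
      exact Finset.card_pos.2 ⟨β, Finset.mem_filter.2 ⟨Finset.mem_univ _, 1, by simp⟩⟩
    have h2 := Finset.eq_of_subset_of_card_le hsub (by rw [hcard, h1])
    have h3 : γ ∈ S := by
      rw [h2]
      simp [hT, hγ, hγα]
    exact (Finset.mem_filter.1 h3).2
  · intro g hg Δ₁ h1
    obtain ⟨g', h2, rfl⟩ := (Finset.mem_filter.1 h1).2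
    refine Finset.mem_filter.2 ⟨Finset.mem_univ _, g * g', ?_, mul_smul _ _ _⟩
    rw [mul_smul, h2, hg]
  · intro h
    simpa [hT] using hsub h

theorem supp_smul (H : ImprimitiveDesign G cl inc lam v k c d ℓ)
    (g : G) (B : 𝔅) : supp cl inc (g • B) = (supp cl inc B).image (g • ·) := by
  ext Δ
  rw [Finset.mem_image]
  constructor
  · intro h
    refine ⟨g⁻¹ • Δ, ?_, by simp⟩
    rw [← H.smul_mem_supp g]
    simpa using h
  · rintro ⟨Δ, h, rfl⟩
    exact (H.smul_mem_supp g).2 h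

theorem supp_smul_eq_iff (H : ImprimitiveDesign G cl inc lam v k c d ℓ) (g : G) {B D : 𝔅} :
    supp cl inc (g • B) = supp cl inc (g • D) ↔ supp cl inc B = supp cl inc D := by
  rw [H.supp_smul, H.supp_smul]
  exact (Finset.image_injective (MulAction.injective g)).eq_iff

theorem supp_smul_of_forall (H : ImprimitiveDesign G cl inc lam v k c d ℓ)
    {g : G} (hg : ∀ Δ : C, g • Δ = Δ) (B : 𝔅) :
    supp cl inc (g • B) = supp cl inc B := by
  rw [H.supp_smul]
  simp [hg]

/-- The number of blocks with a given support. -/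
theorem card_supp_eq (H : ImprimitiveDesign G cl inc lam v k c d ℓ) (hk : 0 < k) (B D : 𝔅) :
    (Finset.univ.filter fun B' => supp cl inc B' = supp cl inc B).card =
      (Finset.univ.filter fun B' => supp cl inc B' = supp cl inc D).card := by
  obtain ⟨g, rfl⟩ := H.exists_smul_block hk B D
  refine Finset.card_bij (fun B' _ => g • B') ?_ ?_ ?_
  · intro B' h
    simpa [H.supp_smul_eq_iff] using h
  · intro a _ b _ h
    simpa using h
  · intro B' h
    refine ⟨g⁻¹ • B', ?_, by simp⟩
    rw [Finset.mem_filter, ← H.supp_smul_eq_iff g]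
    simpa using h

theorem card_filter_supp (H : ImprimitiveDesign G cl inc lam v k c d ℓ) {μ : ℕ}
    (hμ : ∀ B, (Finset.univ.filter fun D => supp cl inc D = supp cl inc B).card = μ)
    (P : Finset C → Prop) :
    (Finset.univ.filter fun B => P (supp cl inc B)).card =
      ((Finset.univ.filter fun B => P (supp cl inc B)).image (supp cl inc)).card * μ := by
  rw [Finset.card_eq_sum_card_image (supp cl inc)]
  refine Finset.sum_const_nat ?_
  intro s hs
  obtain ⟨B, hB, rfl⟩ := Finset.mem_image.1 hs
  rw [← hμ B, Finset.filter_filter]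
  congr 1
  ext D
  simp only [Finset.mem_filter, Finset.mem_univ, true_and] at hB ⊢
  exact ⟨fun h => h.2, fun h => ⟨h ▸ hB, h⟩⟩

/-- The kernel of the action on the classes is trivial or transitive on each class, provided that
the possible lengths of its orbits are large. -/
theorem exists_kernel_smul (H : ImprimitiveDesign G cl inc lam v k c d ℓ)
    {r : ℕ} (hr : ∀ α, (Finset.univ.filter fun B => inc α B).card = r)
    (hr0 : 0 < r) (hdiv : ∀ n, r ∣ n * lam → 0 < n → n + 1 ≤ c → c < 2 * (n + 1))
    {g₀ : G} (hg₀ : ∀ Δ : C, g₀ • Δ = Δ) (hg₁ : g₀ ≠ 1) {α β : Ω} (hαβ : cl β = cl α) :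
    ∃ g : G, (∀ Δ : C, g • Δ = Δ) ∧ g • α = β := by
  have hconj : ∀ x g : G, (∀ Δ : C, g • Δ = Δ) → ∀ Δ : C, (x * g * x⁻¹) • Δ = Δ := by
    intro x g hg Δ
    rw [mul_smul, mul_smul, hg, smul_inv_smul]
  set S : Ω → Finset Ω := fun α => Finset.univ.filter fun γ =>
    ∃ g : G, (∀ Δ : C, g • Δ = Δ) ∧ g • α = γ with hS
  have mem_S : ∀ α γ, γ ∈ S α ↔ ∃ g : G, (∀ Δ : C, g • Δ = Δ) ∧ g • α = γ := by simp [hS]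
  have smul_S : ∀ (x : G) α γ, γ ∈ S α → x • γ ∈ S (x • α) := by
    intro x α γ h
    obtain ⟨g, h1, rfl⟩ := (mem_S _ _).1 h
    exact (mem_S _ _).2 ⟨x * g * x⁻¹, hconj x g h1, by simp [mul_smul]⟩
  have self_S : ∀ α, α ∈ S α := fun α => (mem_S _ _).2 ⟨1, by simp, by simp⟩
  have hle : ∀ α β, (S α).card ≤ (S β).card := by
    intro α β
    obtain ⟨x, rfl⟩ := H.exists_smul_point hr hr0 α β
    exact Finset.card_le_card_of_injOn (x • ·) (fun γ h => smul_S x α γ h)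
      (MulAction.injective x).injOn
  have hsub : ∀ α, S α ⊆ Finset.univ.filter fun γ => cl γ = cl α := by
    intro α γ h
    obtain ⟨g, h1, rfl⟩ := (mem_S _ _).1 h
    simp [H.cl_smul, h1]
  have hne : ∃ γ : Ω, g₀ • γ ≠ γ := by
    by_contra! h
    exact hg₁ (H.faithful _ h)
  have hbig : c < 2 * (S α).card := by
    have h1 : ((S α).erase α).card + 1 = (S α).card :=
      Finset.card_erase_add_one (self_S α)
    rw [← h1]
    apply hdiv
    · refine H.dvd_card_points α _ ?_ (hr α) (by simp)
      intro g hg γ hγ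
      rw [Finset.mem_erase] at hγ ⊢
      refine ⟨fun h => hγ.1 (smul_left_cancel g (h.trans hg.symm)), ?_⟩
      have := smul_S g α γ hγ.2
      rwa [hg] at this
    · obtain ⟨γ, hγ⟩ := hne
      have h2 : 1 < (S γ).card :=
        Finset.one_lt_card.2 ⟨γ, self_S γ, g₀ • γ, (mem_S _ _).2 ⟨g₀, hg₀, rfl⟩, hγ.symm⟩
      have := hle γ α
      omega
    · rw [h1, ← H.card_fiber (cl α)]
      exact Finset.card_le_card (hsub α)
  rw [← mem_S]
  by_contra hβ
  have hdisj : Disjoint (S α) (S β) := by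
    rw [Finset.disjoint_left]
    intro γ h1 h2
    obtain ⟨g, h3, rfl⟩ := (mem_S _ _).1 h1
    obtain ⟨g', h4, h5⟩ := (mem_S _ _).1 h2
    refine hβ ((mem_S _ _).2 ⟨g'⁻¹ * g, ?_, ?_⟩)
    · intro Δ
      rw [mul_smul, h3, inv_smul_eq_iff, h4]
    · rw [mul_smul, ← h5, inv_smul_smul]
  have h1 : (S α ∪ S β).card ≤ c := by
    rw [← H.card_fiber (cl α)]
    refine Finset.card_le_card (Finset.union_subset (hsub α) ?_)
    rw [← hαβ]
    exact hsub β
  rw [Finset.card_union_of_disjoint hdisj] at h1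
  have := hle α β
  omega

/-- If the kernel on classes is transitive on each class, the number of blocks with a given support
through a given point is determined by the number `μ` of blocks with a given support. -/
theorem card_through_supp_eq (H : ImprimitiveDesign G cl inc lam v k c d ℓ) {μ : ℕ}
    (hμ : ∀ B, (Finset.univ.filter fun D => supp cl inc D = supp cl inc B).card = μ)
    (htrans : ∀ α β : Ω, cl β = cl α → ∃ g : G, (∀ Δ : C, g • Δ = Δ) ∧ g • α = β)
    {α : Ω} {B : 𝔅} (hα : inc α B) :
    μ * ℓ = c * (Finset.univ.filter fun D => supp cl inc D = supp cl inc B ∧ inc α D).card := by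
  have := H.card_filter_mem_supp (fun D => supp cl inc D = supp cl inc B) (cl α)
    (m := (Finset.univ.filter fun D => supp cl inc D = supp cl inc B ∧ inc α D).card) ?_
  · rw [← this, ← hμ B]
    congr 2
    ext D
    simp only [Finset.mem_filter, Finset.mem_univ, true_and]
    exact ⟨fun h => ⟨h, h ▸ mem_supp.2 ⟨α, hα, rfl⟩⟩, fun h => h.1⟩
  · intro β hβ
    obtain ⟨g, h1, rfl⟩ := htrans α β hβ
    symm
    refine Finset.card_bij (fun D _ => g • D) ?_ ?_ ?_
    · intro D hD
      simpa [H.inc_smul_iff, H.supp_smul_of_forall h1] using hD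
    · intro a _ b _ h
      simpa using h
    · intro D hD
      refine ⟨g⁻¹ • D, ?_, by simp⟩
      simp only [Finset.mem_filter, Finset.mem_univ, true_and] at hD ⊢
      rw [← H.inc_smul_iff g, ← H.supp_smul_of_forall h1 (g⁻¹ • D), smul_inv_smul]
      exact hD

end

end ImprimitiveDesign

theorem even_card_of_matching {X : Type*} (S : Finset X) (R : X → X → Prop)
    (hsymm : ∀ a b, R a b → R b a) (hirr : ∀ a, ¬ R a a)
    (hex : ∀ a ∈ S, ∃ b ∈ S, R a b) (huniq : ∀ a b b', R a b → R a b' → b = b') :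
    Even S.card := by
  choose! f hf hf' using hex
  have h : ∑ a ∈ S, (1 : ZMod 2) = 0 := by
    refine Finset.sum_involution (fun a _ => f a) ?_ ?_ ?_ ?_
    · intro a _
      exact CharTwo.add_self_eq_zero 1
    · intro a ha _ h
      have := hf' a ha
      rw [h] at this
      exact hirr a this
    · exact fun a ha => hf a ha
    · intro a ha
      exact huniq _ _ _ (hf' _ (hf a ha)) (hsymm _ _ (hf' a ha))
  rw [Finset.sum_const, nsmul_eq_mul, mul_one, ZMod.natCast_eq_zero_iff] at h
  exact even_iff_two_dvd.2 h

/-- The size of an orbit of a subgroup divides the order of the subgroup. -/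
theorem card_dvd_card_subgroup {G X : Type*} [Group G] [MulAction G X] (K : Subgroup G)
    (S : Finset X) (x : X) (hS : ∀ y, y ∈ S ↔ ∃ g ∈ K, g • x = y) : S.card ∣ Nat.card K := by
  have h : (S : Set X) = orbit K x := by
    ext y
    rw [Finset.mem_coe, hS, mem_orbit_iff]
    exact ⟨fun ⟨g, h1, h2⟩ => ⟨⟨g, h1⟩, h2⟩, fun ⟨g, h⟩ => ⟨g, g.2, h⟩⟩
  rw [← Set.ncard_coe_finset, h, ← index_stabilizer]
  exact Subgroup.index_dvd_card _

namespace ImprimitiveDesign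

section

open scoped Classical

variable {G Ω C 𝔅 : Type*} [Group G] [Fintype Ω] [Fintype C]
    [Fintype 𝔅] [MulAction G Ω] [MulAction G C] [MulAction G 𝔅] {cl : Ω → C}
    {inc : Ω → 𝔅 → Prop} {lam v k c d ℓ : ℕ}

theorem smul_eq_of_supp (H : ImprimitiveDesign G cl inc lam v k c d ℓ)
    {g : G} (hg : ∀ Δ : C, g • Δ = Δ)
    (ht : ∀ {α B D}, inc α B → inc α D → supp cl inc D = supp cl inc B → D = B) {α : Ω} {B : 𝔅}
    (h : inc α B) (h' : inc (g • α) B) : g • B = B :=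
  ht h' (H.inc_smul g h) (H.supp_smul_of_forall hg B)

theorem exists_block_of_ne (H : ImprimitiveDesign G cl inc lam v k c d ℓ)
    (hlam : 0 < lam) {α β : Ω} (h : α ≠ β) : ∃ B, inc α B ∧ inc β B := by
  rw [← H.card_pair h, Finset.card_pos] at hlam
  obtain ⟨B, hB⟩ := hlam
  exact ⟨B, by simpa using hB⟩

theorem exists_card_supp_eq (H : ImprimitiveDesign G cl inc lam v k c d ℓ) (hk : 0 < k) : ∃ μ, ∀ B,
    (Finset.univ.filter fun D => supp cl inc D = supp cl inc B).card = μ := by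
  by_cases h : Nonempty 𝔅
  · obtain ⟨B⟩ := h
    exact ⟨_, fun D => H.card_supp_eq hk D B⟩
  · exact ⟨0, fun D => (h ⟨D⟩).elim⟩

theorem eq_of_card_through_supp_eq (H : ImprimitiveDesign G cl inc lam v k c d ℓ) {μ : ℕ}
    (hμ : ∀ B, (Finset.univ.filter fun D => supp cl inc D = supp cl inc B).card = μ)
    (htrans : ∀ α β : Ω, cl β = cl α → ∃ g : G, (∀ Δ : C, g • Δ = Δ) ∧ g • α = β)
    (h1 : ∀ t, μ * ℓ = c * t → t ≤ 1)
    {α : Ω} {B D : 𝔅} (hB : inc α B) (hD : inc α D) (h : supp cl inc D = supp cl inc B) :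
    D = B := by
  have := h1 _ (H.card_through_supp_eq hμ htrans hB)
  rw [Finset.card_le_one] at this
  exact this D (by simp [h, hD]) B (by simp [hB])

theorem dvd_card_filter_supp (H : ImprimitiveDesign G cl inc lam v k c d ℓ) {μ : ℕ}
    (hμ : ∀ B, (Finset.univ.filter fun D => supp cl inc D = supp cl inc B).card = μ)
    (P : Finset C → Prop) : μ ∣ (Finset.univ.filter fun B => P (supp cl inc B)).card := by
  rw [H.card_filter_supp hμ P]
  exact dvd_mul_left _ _

end

section

open scoped Classical

variable {G Ω C 𝔅 : Type*} [Group G] [Fintype Ω] [Fintype C]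
    [Fintype 𝔅] [MulAction G Ω] [MulAction G C] [MulAction G 𝔅] {cl : Ω → C}
    {inc : Ω → 𝔅 → Prop} {lam v k c d ℓ : ℕ}

/-- The basic numerical invariants: `r` blocks through a point, `b` blocks, `R` blocks meeting a
class, `x` blocks through a point and meeting another class, `L` blocks meeting two classes, and
`s` classes met by a block. -/
structure Counts (cl : Ω → C) (inc : Ω → 𝔅 → Prop) (r b R x L s : ℕ) : Prop where
  through : ∀ α, (Finset.univ.filter fun B => inc α B).card = r
  blocks : Fintype.card 𝔅 = b
  meeting : ∀ Δ, (Finset.univ.filter fun B => Δ ∈ supp cl inc B).card = R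
  through_meeting : ∀ α Δ, Δ ≠ cl α →
    (Finset.univ.filter fun B => inc α B ∧ Δ ∈ supp cl inc B).card = x
  meeting_two : ∀ Δ Δ', Δ ≠ Δ' →
    (Finset.univ.filter fun B => Δ ∈ supp cl inc B ∧ Δ' ∈ supp cl inc B).card = L
  support : ∀ B, (supp cl inc B).card = s

theorem counts (H : ImprimitiveDesign G cl inc lam v k c d ℓ) {r b R x L s : ℕ} (hk : 1 < k)
    (hℓ : 0 < ℓ) (h1 : r * (k - 1) = (v - 1) * lam) (h2 : b * k = v * r) (h3 : x * ℓ = c * lam)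
    (h4 : R * ℓ = c * r) (h5 : L * ℓ = c * x) (h6 : s * ℓ = k) : Counts cl inc r b R x L s := by
  have hr : ∀ α, (Finset.univ.filter fun B => inc α B).card = r := fun α =>
    Nat.eq_of_mul_eq_mul_right (by omega) ((H.card_through α).trans h1.symm)
  have hx : ∀ α Δ, Δ ≠ cl α →
      (Finset.univ.filter fun B => inc α B ∧ Δ ∈ supp cl inc B).card = x :=
    fun α Δ h => Nat.eq_of_mul_eq_mul_right hℓ ((H.card_through_mem_supp h).trans h3.symm)
  refine ⟨hr, ?_, fun Δ => ?_, hx, fun Δ Δ' h => ?_, fun B => ?_⟩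
  · exact Nat.eq_of_mul_eq_mul_right (by omega) ((H.card_blocks hr).trans h2.symm)
  · exact Nat.eq_of_mul_eq_mul_right hℓ ((H.card_mem_supp hr Δ).trans h4.symm)
  · refine Nat.eq_of_mul_eq_mul_right hℓ
      ((H.card_mem_supp_mem_supp (x := x) fun α hα => hx α Δ ?_).trans h5.symm)
    rwa [hα]
  · exact Nat.eq_of_mul_eq_mul_right hℓ ((H.card_supp B).trans h6.symm)

theorem counts₁ (H : ImprimitiveDesign G cl inc 3 256 18 16 16 2) :
    Counts cl inc 45 640 360 24 192 9 :=
  H.counts (by simp) (by simp) (by simp) (by simp) (by simp) (by simp) (by simp) (by simp)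

theorem counts₂ (H : ImprimitiveDesign G cl inc 4 231 24 21 11 3) :
    Counts cl inc 40 385 280 28 196 8 :=
  H.counts (by simp) (by simp) (by simp) (by simp) (by simp) (by simp) (by simp) (by simp)

theorem counts₃ (H : ImprimitiveDesign G cl inc 4 484 24 22 22 2) :
    Counts cl inc 84 1694 924 44 484 12 :=
  H.counts (by simp) (by simp) (by simp) (by simp) (by simp) (by simp) (by simp) (by simp)

theorem Counts.dvd_gcd {r b R x L s : ℕ} (N : Counts cl inc r b R x L s)
    (H : ImprimitiveDesign G cl inc lam v k c d ℓ) (hd : 1 < d) {μ : ℕ}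
    (hμ : ∀ B, (Finset.univ.filter fun D => supp cl inc D = supp cl inc B).card = μ) :
    μ ∣ Nat.gcd b (Nat.gcd R L) := by
  obtain ⟨Δ, Δ', h⟩ : ∃ Δ Δ' : C, Δ ≠ Δ' := by
    rw [← H.card_class] at hd
    exact Fintype.exists_pair_of_one_lt_card hd
  refine Nat.dvd_gcd ?_ (Nat.dvd_gcd ?_ ?_)
  · have := H.dvd_card_filter_supp hμ fun _ => True
    rwa [Finset.filter_true, Finset.card_univ, N.blocks] at this
  · have := H.dvd_card_filter_supp hμ fun s => Δ ∈ s
    convert this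
    convert (N.meeting Δ).symm
  · have := H.dvd_card_filter_supp hμ fun s => Δ ∈ s ∧ Δ' ∈ s
    convert this
    convert (N.meeting_two Δ Δ' h).symm

theorem mem_ker_iff {g : G} : g ∈ (toPermHom G C).ker ↔ ∀ Δ : C, g • Δ = Δ := by
  rw [MonoidHom.mem_ker, Equiv.ext_iff]
  rfl

theorem exists_kernel_element [Finite G] (H : ImprimitiveDesign G cl inc lam v k c d ℓ)
    (htrans : ∀ α β : Ω, cl β = cl α → ∃ g : G, (∀ Δ : C, g • Δ = Δ) ∧ g • α = β) (α : Ω)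
    (p : ℕ) [Fact p.Prime] (hp : p ∣ c) :
    ∃ g : G, (∀ Δ : C, g • Δ = Δ) ∧ orderOf g = p := by
  have h := card_dvd_card_subgroup (toPermHom G C).ker
    (Finset.univ.filter fun β => cl β = cl α) α ?_
  · rw [H.card_fiber] at h
    obtain ⟨g, hg⟩ := exists_prime_orderOf_dvd_card' (G := (toPermHom G C).ker) p (hp.trans h)
    exact ⟨g, mem_ker_iff.1 g.2, by rwa [Subgroup.orderOf_coe]⟩
  · intro β
    simp only [Finset.mem_filter, Finset.mem_univ, true_and, mem_ker_iff]
    refine ⟨htrans α β, ?_⟩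
    rintro ⟨g, h1, rfl⟩
    rw [H.cl_smul, h1]

theorem exists_moved (H : ImprimitiveDesign G cl inc lam v k c d ℓ) {g : G} (hg : g ≠ 1) :
    ∃ α : Ω, g • α ≠ α := by
  by_contra! h
  exact hg (H.faithful g h)

theorem kernel_trivial₂ [Finite G] (H : ImprimitiveDesign G cl inc 4 231 24 21 11 3) (g : G)
    (hg : ∀ Δ : C, g • Δ = Δ) : g = 1 := by
  by_contra hg1
  have N := H.counts₂
  have htrans : ∀ α β : Ω, cl β = cl α → ∃ g : G, (∀ Δ : C, g • Δ = Δ) ∧ g • α = β :=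
    fun α β h => H.exists_kernel_smul N.through (by simp) (by intro n; omega) hg hg1 h
  obtain ⟨μ, hμ⟩ := H.exists_card_supp_eq (by simp)
  have hμ7 : μ ∣ 7 := N.dvd_gcd H (by simp) hμ
  have ht : ∀ {α B D}, inc α B → inc α D → supp cl inc D = supp cl inc B → D = B :=
    fun h1 h2 h3 => H.eq_of_card_through_supp_eq hμ htrans
      (by have := Nat.le_of_dvd (by simp) hμ7; intro t; omega) h1 h2 h3
  obtain ⟨α₀, -⟩ := H.exists_moved hg1
  have : Fact (Nat.Prime 7) := ⟨by norm_num⟩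
  obtain ⟨w, hw, hw7⟩ := H.exists_kernel_element htrans α₀ 7 (by simp)
  have hw1 : w ^ 7 = 1 := hw7 ▸ pow_orderOf_eq_one w
  obtain ⟨α, hα⟩ := H.exists_moved (g := w) (by rintro rfl; simp at hw7)
  obtain ⟨B, hB, hB'⟩ := H.exists_block_of_ne (by simp) hα.symm
  have hwB := H.smul_eq_of_supp hw ht hB hB'
  have hpow : ∀ i : ℕ, inc (w ^ i • α) B ∧ cl (w ^ i • α) = cl α := by
    intro i
    induction i with
    | zero => simpa using hB
    | succ i ih =>
      rw [pow_succ', mul_smul, H.cl_smul, hw]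
      refine ⟨?_, ih.2⟩
      have := H.inc_smul w ih.1
      rwa [hwB] at this
  have hno : ∀ m s : ℕ, m * s % 7 = 1 → w ^ m • α ≠ α := by
    intro m s hms h
    have h1 : w ^ (m * s) = w := by
      rw [← Nat.div_add_mod (m * s) 7, hms, pow_add, pow_mul, hw1]
      simp
    have h2 : ∀ s : ℕ, (w ^ m) ^ s • α = α := by
      intro s
      induction s with
      | zero => simp
      | succ s ih => rw [pow_succ, mul_smul, h, ih]
    apply hα
    rw [← h1, pow_mul, h2]
  have hinj : Set.InjOn (fun i : ℕ => w ^ i • α) (Finset.range 4 : Set ℕ) := by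
    have key : ∀ i j : ℕ, i < j → j < 4 → w ^ i • α ≠ w ^ j • α := by
      intro i j hij hj h
      obtain ⟨m, rfl⟩ := Nat.exists_eq_add_of_lt hij
      rw [add_assoc, pow_add, mul_smul] at h
      have h' := (smul_left_cancel _ h).symm
      have hm : m < 3 := by omega
      interval_cases m
      · exact hno 1 1 rfl h'
      · exact hno 2 4 rfl h'
      · exact hno 3 5 rfl h'
    intro i hi j hj h
    simp only [Finset.coe_range, Set.mem_Iio] at hi hj
    rcases lt_trichotomy i j with h1 | h1 | h1
    · exact (key i j h1 hj h).elim
    · exact h1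
    · exact (key j i h1 hi h.symm).elim
  have h4 := Finset.card_le_card_of_injOn (t := Finset.univ.filter fun β => inc β B ∧ cl β = cl α)
    _ (fun i _ => by simpa using hpow i) hinj
  rw [H.card_inter hB, Finset.card_range] at h4
  omega

theorem kernel_trivial₁ (H : ImprimitiveDesign G cl inc 3 256 18 16 16 2) (g : G)
    (hg : ∀ Δ : C, g • Δ = Δ) : g = 1 := by
  by_contra hg1
  have N := H.counts₁
  have htrans : ∀ α β : Ω, cl β = cl α → ∃ g : G, (∀ Δ : C, g • Δ = Δ) ∧ g • α = β :=
    fun α β h => H.exists_kernel_smul N.through (by simp) (by intro n; omega) hg hg1 h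
  obtain ⟨μ, hμ⟩ := H.exists_card_supp_eq (by simp)
  have hμ8 : μ ∣ 8 := N.dvd_gcd H (by simp) hμ
  have ht : ∀ {α B D}, inc α B → inc α D → supp cl inc D = supp cl inc B → D = B :=
    fun h1 h2 h3 => H.eq_of_card_through_supp_eq hμ htrans
      (by have := Nat.le_of_dvd (by simp) hμ8; intro t; omega) h1 h2 h3
  have hfix : ∀ {α B}, inc α B → g • α = α → g • B = B := fun h h' =>
    H.smul_eq_of_supp hg ht h (by rwa [h'])
  have hclass : ∀ {α β}, g • α = α → cl β = cl α → g • β = β := by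
    intro α β hα hβ
    by_contra hne
    have hαβ : α ≠ β := by
      rintro rfl
      exact hne hα
    obtain ⟨B, h1, h2⟩ := H.exists_block_of_ne (by simp) hαβ
    have h3 : inc (g • β) B := by
      have := H.inc_smul g h2
      rwa [hfix h1 hα] at this
    have : 2 < (Finset.univ.filter fun γ => inc γ B ∧ cl γ = cl α).card := by
      refine Finset.two_lt_card.2 ⟨α, by simp [h1], β, by simp [h2, hβ], g • β, ?_, hαβ, ?_,
        fun h => hne h.symm⟩
      · simp [h3, H.cl_smul, hg, hβ]
      · intro h
        exact hαβ (smul_left_cancel g (hα.trans h))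
    rw [H.card_inter h1] at this
    omega
  have hfree : ∀ α : Ω, g • α ≠ α := by
    intro α hα
    obtain ⟨β, hβ⟩ := H.exists_moved hg1
    have hsub : ∀ α' : Ω, cl α' = cl α → ∀ B, inc β B → inc (g • β) B → inc α' B := by
      intro α' hα' 
      have h1 : g • α' = α' := hclass hα hα'
      have h2 : α' ≠ β := by
        rintro rfl
        exact hβ h1
      have h3 : (Finset.univ.filter fun B => inc α' B ∧ inc β B) ⊆
          Finset.univ.filter fun B => inc β B ∧ inc (g • β) B := by
        intro B hB
        simp only [Finset.mem_filter, Finset.mem_univ, true_and] at hB ⊢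
        refine ⟨hB.2, ?_⟩
        have := H.inc_smul g hB.2
        rwa [hfix hB.1 h1] at this
      have h4 := Finset.eq_of_subset_of_card_le h3 (by rw [H.card_pair h2, H.card_pair hβ.symm])
      intro B h5 h6
      have : B ∈ Finset.univ.filter fun B => inc α' B ∧ inc β B := by
        rw [h4]
        simp [h5, h6]
      exact (Finset.mem_filter.1 this).2.1
    obtain ⟨B, h1, h2⟩ := H.exists_block_of_ne (by simp) hβ.symm
    have h3 : (Finset.univ.filter fun γ => cl γ = cl α) ⊆
        Finset.univ.filter fun γ => inc γ B ∧ cl γ = cl α := by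
      intro γ hγ
      simp only [Finset.mem_filter, Finset.mem_univ, true_and] at hγ ⊢
      exact ⟨hsub γ hγ B h1 h2, hγ⟩
    have h4 := Finset.card_le_card h3
    rw [H.card_fiber, H.card_inter (hsub α rfl B h1 h2)] at h4
    omega
  have hsum := Finset.sum_card_bipartiteAbove_eq_sum_card_bipartiteBelow
    (s := (Finset.univ : Finset Ω)) (t := (Finset.univ : Finset 𝔅))
    fun α B => inc α B ∧ inc (g • α) B
  have h1 : ∑ α : Ω, (Finset.bipartiteAbove (fun α B => inc α B ∧ inc (g • α) B)
      (Finset.univ : Finset 𝔅) α).card = 768 := by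
    rw [Finset.sum_const_nat (m := 3), Finset.card_univ, H.card_point]
    intro α _
    exact H.card_pair (hfree α).symm
  have h2 : 18 ∣ ∑ B : 𝔅, (Finset.bipartiteBelow (fun α B => inc α B ∧ inc (g • α) B)
      (Finset.univ : Finset Ω) B).card := by
    refine Finset.dvd_sum fun B _ => ?_
    by_cases hB : g • B = B
    · rw [← H.card_block B]
      refine dvd_of_eq ?_
      congr 1
      ext α
      simp only [Finset.mem_bipartiteBelow, Finset.mem_filter, Finset.mem_univ, true_and]
      refine ⟨fun h => ⟨h, ?_⟩, fun h => h.1⟩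
      have := H.inc_smul g h
      rwa [hB] at this
    · rw [Finset.card_eq_zero.2]
      · simp
      · rw [Finset.bipartiteBelow, Finset.filter_eq_empty_iff]
        intro α _ h
        exact hB (H.smul_eq_of_supp hg ht h.1 h.2)
  rw [← hsum, h1] at h2
  omega

end

end ImprimitiveDesign

section

open scoped Classical

variable {G X : Type*} [Group G] [MulAction G X]

theorem card_modEq_card_fixed [Finite G] {p : ℕ} [Fact p.Prime] {T : Subgroup G}
    (hT : IsPGroup p T) (S : Finset X) (hS : ∀ t ∈ T, ∀ x ∈ S, t • x ∈ S) :
    S.card ≡ (S.filter fun x => ∀ t ∈ T, t • x = x).card [MOD p] := by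
  let Y : SubMulAction T X := ⟨(S : Set X), fun t x hx => hS t t.2 x hx⟩
  have : Finite Y := inferInstanceAs (Finite (S : Set X))
  have h := hT.card_modEq_card_fixedPoints Y
  have h1 : Nat.card Y = S.card := by
    change Nat.card (S : Set X) = _
    rw [Nat.card_coe_set_eq, Set.ncard_coe_finset]
  have h2 : Nat.card (fixedPoints T Y) = (S.filter fun x => ∀ t ∈ T, t • x = x).card := by
    rw [← Set.ncard_coe_finset, ← Nat.card_coe_set_eq]
    refine Nat.card_congr ⟨fun y => ⟨y.1.1, ?_⟩, fun x => ⟨⟨x.1, ?_⟩, ?_⟩, fun _ => rfl,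
      fun _ => rfl⟩
    · have h3 := y.2
      rw [mem_fixedPoints] at h3
      rw [Finset.mem_coe, Finset.mem_filter]
      exact ⟨y.1.2, fun t ht => congrArg Subtype.val (h3 ⟨t, ht⟩)⟩
    · have h3 := x.2
      rw [Finset.mem_coe, Finset.mem_filter] at h3
      exact h3.1
    · have h3 := x.2
      rw [Finset.mem_coe, Finset.mem_filter] at h3
      rw [mem_fixedPoints]
      exact fun t => Subtype.ext (h3.2 t t.2)
  rwa [h1, h2] at h

theorem card_modEq_card_fixed_of_pow [Finite G] {p : ℕ} [Fact p.Prime] {w : G}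
    (hw : w ^ p = 1) (S : Finset X) (hS : ∀ x ∈ S, w • x ∈ S) :
    S.card ≡ (S.filter fun x => w • x = x).card [MOD p] := by
  have hT : IsPGroup p (Subgroup.zpowers w) := by
    rintro ⟨t, ht⟩
    obtain ⟨n, hn⟩ := Subgroup.mem_zpowers_iff.1 ht
    have htp : t ^ p = 1 := by
      rw [← hn, ← zpow_natCast, ← zpow_mul, mul_comm, zpow_mul, zpow_natCast, hw, one_zpow]
    exact ⟨1, Subtype.ext (by simpa using htp)⟩
  have hnat : ∀ n : ℕ, ∀ x ∈ S, w ^ n • x ∈ S := by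
    intro n x hx
    induction n with
    | zero => simpa
    | succ n ih =>
      rw [pow_succ', mul_smul]
      exact hS _ ih
  have h := card_modEq_card_fixed hT S ?_
  · convert h using 4 with x
    refine ⟨fun hx t ht => ?_, fun hx => hx w (Subgroup.mem_zpowers w)⟩
    have : Subgroup.zpowers w ≤ stabilizer G x := by
      rwa [Subgroup.zpowers_le]
    exact this ht
  · intro t ht
    obtain ⟨n, rfl⟩ := mem_powers_iff_mem_zpowers.2 ht
    exact hnat n

theorem exists_smul_finset_eq [Fintype X]
    (h2 : ∀ a b c d : X, a ≠ b → c ≠ d → ∃ g : G, g • a = c ∧ g • b = d) {p : ℕ} (hp : p.Prime)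
    {w : G} (hw : w ^ p = 1) (hmov : (Finset.univ.filter fun x : X => w • x ≠ x).card = p)
    (hpX : p < Fintype.card X) {m : ℕ} (hm : m + p ≤ Fintype.card X + 1) {s t : Finset X}
    (hs : s.card = m) (ht : t.card = m) : ∃ g : G, s.image (g • ·) = t := by
  set σ : Equiv.Perm X := toPermHom G X w with hσ
  have hσ_apply : ∀ x, σ x = w • x := fun _ => rfl
  have hsupp : σ.support = Finset.univ.filter fun x : X => w • x ≠ x := by
    ext x
    simp [hσ_apply]
  have hord : orderOf σ = p := by
    have : Fact p.Prime := ⟨hp⟩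
    refine orderOf_eq_prime ?_ ?_
    · rw [hσ, ← map_pow, hw, map_one]
    · intro h
      rw [h, Equiv.Perm.support_one] at hsupp
      rw [← hsupp] at hmov
      exact hp.ne_zero hmov.symm
  have hcyc : σ.IsCycle := by
    refine Equiv.Perm.isCycle_of_prime_order (by rwa [hord]) ?_
    rw [hsupp, hmov, hord]
    have := hp.pos
    omega
  set F : Set X := {x | w • x = x} with hF
  have hFc : F.ncard + p = Fintype.card X := by
    have h1 : F = ((Finset.univ.filter fun x : X => w • x ≠ x)ᶜ : Finset X) := by
      ext x
      simp [hF]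
    rw [h1, Set.ncard_coe_finset, ← hmov]
    exact Finset.card_compl_add_card _
  obtain ⟨n, hn⟩ : ∃ n, F.ncard = n + 1 := ⟨F.ncard - 1, by omega⟩
  have hprim : IsPreprimitive G X := isPreprimitive_of_is_two_pretransitive
    (is_two_pretransitive_iff.2 fun {a b c d} h h' => h2 a b c d h h')
  have htrans : IsPretransitive (fixingSubgroup G F) (SubMulAction.ofFixingSubgroup G F) := by
    refine ⟨fun x y => ?_⟩
    have hx : σ x ≠ x := fun h => x.2 h
    have hy : σ y ≠ y := fun h => y.2 h
    obtain ⟨i, hi⟩ := hcyc.exists_zpow_eq hx hy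
    refine ⟨⟨w ^ i, ?_⟩, ?_⟩
    · have h1 : w ∈ fixingSubgroup G F := mem_fixingSubgroup_iff G |>.2 fun y hy => hy
      exact Subgroup.zpow_mem _ h1 i
    · apply Subtype.ext
      rw [← hi, hσ, ← map_zpow]
      rfl
  have hprim' : IsPreprimitive (fixingSubgroup G F) (SubMulAction.ofFixingSubgroup G F) := by
    refine IsPreprimitive.of_prime_card ?_
    have : Nat.card (SubMulAction.ofFixingSubgroup G F) = p := by
      change Nat.card (Fᶜ : Set X) = p
      rw [Nat.card_coe_set_eq]
      have := Set.ncard_add_ncard_compl F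
      rw [Nat.card_eq_fintype_card] at this
      omega
    rwa [this]
  have hp2 := hp.two_le
  have hmult := hprim.isMultiplyPreprimitive hn (by rw [Nat.card_eq_fintype_card]; omega) hprim'
  have hmt : IsMultiplyPretransitive G X (n + 2) := hmult.isMultiplyPretransitive
  have hmt' : IsMultiplyPretransitive G X m :=
    isMultiplyPretransitive_of_le (n := n + 2) (by omega)
      (by rw [Nat.card_eq_fintype_card]; omega)
  have hpt := Set.powersetCard.isPretransitive_of_isMultiplyPretransitive G hmt'
  obtain ⟨g, hg⟩ := hpt.exists_smul_eq ⟨s, hs⟩ ⟨t, ht⟩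
  refine ⟨g, ?_⟩
  have := congrArg (Subtype.val) hg
  rw [Set.powersetCard.coe_smul] at this
  exact this

theorem exists_smul_finset_eq_of_compl [Fintype X]
    (h2 : ∀ a b c d : X, a ≠ b → c ≠ d → ∃ g : G, g • a = c ∧ g • b = d) {p : ℕ} (hp : p.Prime)
    {w : G} (hw : w ^ p = 1) (hmov : (Finset.univ.filter fun x : X => w • x ≠ x).card = p)
    (hpX : p < Fintype.card X) {m : ℕ} (hm : p ≤ m + 1) {s t : Finset X}
    (hs : s.card = m) (ht : t.card = m) : ∃ g : G, s.image (g • ·) = t := by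
  have hmX : m ≤ Fintype.card X := hs ▸ Finset.card_le_univ s
  obtain ⟨g, hg⟩ := exists_smul_finset_eq h2 hp hw hmov hpX (m := Fintype.card X - m)
    (by omega) (s := sᶜ) (t := tᶜ) (by rw [Finset.card_compl, hs])
    (by rw [Finset.card_compl, ht])
  refine ⟨g, Finset.eq_of_subset_of_card_le ?_ ?_⟩
  · intro y hy
    obtain ⟨x, hx, rfl⟩ := Finset.mem_image.1 hy
    by_contra h
    rw [← Finset.mem_compl, ← hg, Finset.mem_image] at h
    obtain ⟨x', hx', h'⟩ := h
    rw [smul_left_cancel g h'] at hx'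
    exact Finset.mem_compl.1 hx' hx
  · rw [Finset.card_image_of_injective _ (MulAction.injective g), hs, ht]

end

namespace ImprimitiveDesign

section

open scoped Classical

variable {G Ω C 𝔅 : Type*} [Group G] [Fintype Ω] [Fintype C]
    [Fintype 𝔅] [MulAction G Ω] [MulAction G C] [MulAction G 𝔅] {cl : Ω → C}
    {inc : Ω → 𝔅 → Prop} {lam v k c d ℓ : ℕ}

theorem two_transitive (H : ImprimitiveDesign G cl inc lam v k c d ℓ) {r x : ℕ}
    (hr : ∀ α, (Finset.univ.filter fun B => inc α B).card = r)
    (hx : ∀ α Δ, Δ ≠ cl α →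
      (Finset.univ.filter fun B => inc α B ∧ Δ ∈ supp cl inc B).card = x)
    (hr0 : 0 < r) (hc : 0 < c) (hdiv : ∀ n, r ∣ n * x → 0 < n → n ≤ d - 1 → n = d - 1)
    (Δ₁ Δ₂ Δ₃ Δ₄ : C) (h₁₂ : Δ₁ ≠ Δ₂) (h₃₄ : Δ₃ ≠ Δ₄) :
    ∃ g : G, g • Δ₁ = Δ₃ ∧ g • Δ₂ = Δ₄ := by
  obtain ⟨α, rfl⟩ := H.exists_mem_fiber hc Δ₁
  obtain ⟨β, rfl⟩ := H.exists_mem_fiber hc Δ₃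
  obtain ⟨g, rfl⟩ := H.exists_smul_point hr hr0 α β
  have h : g • Δ₂ ≠ cl (g • α) := by
    rw [H.cl_smul, Ne, smul_left_cancel_iff]
    exact h₁₂.symm
  obtain ⟨g', h1, h2⟩ := H.exists_smul_class hr hx hdiv h h₃₄.symm
  refine ⟨g' * g, ?_, by rw [mul_smul, h2]⟩
  rw [← H.cl_smul, mul_smul, h1]

/-- If all `s`-subsets of the classes are equivalent, the number of such sets divides the number
of blocks. -/
theorem choose_dvd_card (H : ImprimitiveDesign G cl inc lam v k c d ℓ)
    {r b R x L s : ℕ} (N : Counts cl inc r b R x L s) (hk : 0 < k) (hb : 0 < b)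
    (h : ∀ S T : Finset C, S.card = s → T.card = s → ∃ g : G, S.image (g • ·) = T) :
    d.choose s ∣ b := by
  obtain ⟨μ, hμ⟩ := H.exists_card_supp_eq hk
  have h1 := H.card_filter_supp hμ fun _ => True
  rw [Finset.filter_true, Finset.card_univ, N.blocks] at h1
  have h2 : (Finset.univ : Finset 𝔅).image (supp cl inc) =
      Finset.powersetCard s (Finset.univ : Finset C) := by
    ext S
    rw [Finset.mem_powersetCard_univ, Finset.mem_image]
    refine ⟨?_, fun hS => ?_⟩
    · rintro ⟨B, -, rfl⟩
      exact N.support B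
    · rw [← N.blocks, Fintype.card_pos_iff] at hb
      obtain ⟨B⟩ := hb
      obtain ⟨g, hg⟩ := h _ S (N.support B) hS
      exact ⟨g • B, Finset.mem_univ _, by rw [H.supp_smul, hg]⟩
  rw [h2, Finset.card_powersetCard, Finset.card_univ, H.card_class] at h1
  exact ⟨μ, h1⟩

end

section

open scoped Classical

variable {G Ω C 𝔅 : Type*} [Group G] [Fintype Ω] [Fintype C]
    [Fintype 𝔅] [MulAction G Ω] [MulAction G C] [MulAction G 𝔅] {cl : Ω → C}
    {inc : Ω → 𝔅 → Prop} {lam v k c d ℓ : ℕ}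

theorem kernel_trivial₃ [Finite G] (H : ImprimitiveDesign G cl inc 4 484 24 22 22 2) (g : G)
    (hg : ∀ Δ : C, g • Δ = Δ) : g = 1 := by
  by_contra hg1
  have N := H.counts₃
  have htrans : ∀ α β : Ω, cl β = cl α → ∃ g : G, (∀ Δ : C, g • Δ = Δ) ∧ g • α = β :=
    fun α β h => H.exists_kernel_smul N.through (by simp) (by intro n; omega) hg hg1 h
  have htr : ∀ {α β γ : Ω}, cl β = cl α → β ≠ α → cl γ = cl α → γ ≠ α →
      ∃ g : G, g • α = α ∧ g • β = γ :=
    fun h1 h2 h3 h4 => H.exists_smul_mem_fiber N.through (by intro n; omega) h1 h2 h3 h4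
  have hconj : ∀ x g : G, (∀ Δ : C, g • Δ = Δ) → ∀ Δ : C, (x * g * x⁻¹) • Δ = Δ := by
    intro x g hg Δ
    rw [mul_smul, mul_smul, hg, smul_inv_smul]
  have hinv : ∀ g : G, (∀ Δ : C, g • Δ = Δ) → ∀ Δ : C, g⁻¹ • Δ = Δ := by
    intro g hg Δ
    rw [inv_smul_eq_iff, hg]
  obtain ⟨μ, hμ⟩ := H.exists_card_supp_eq (by simp)
  have hμ22 : μ ∣ 22 := N.dvd_gcd H (by simp) hμ
  have hS : ∀ α : Ω, ((Finset.univ.filter fun β => cl β = cl α).erase α).card = 21 := by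
    intro α
    rw [Finset.card_erase_of_mem (by simp), H.card_fiber]
  have mem_S : ∀ α β : Ω, β ∈ (Finset.univ.filter fun β => cl β = cl α).erase α ↔
      β ≠ α ∧ cl β = cl α := by simp
  have hthree : ∀ {α : Ω} {B : 𝔅}, inc α B → ∀ B₁ B₂ B₃ : 𝔅, inc α B₁ → inc α B₂ → inc α B₃ →
      supp cl inc B₁ = supp cl inc B → supp cl inc B₂ = supp cl inc B →
      supp cl inc B₃ = supp cl inc B → B₁ = B₂ ∨ B₁ = B₃ ∨ B₂ = B₃ := by
    intro α B hB B₁ B₂ B₃ h1 h2 h3 s1 s2 s3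
    have h := H.card_through_supp_eq hμ htrans hB
    have h22 := Nat.le_of_dvd (by simp) hμ22
    by_contra! hne
    have : 2 < (Finset.univ.filter fun D => supp cl inc D = supp cl inc B ∧ inc α D).card :=
      Finset.two_lt_card.2 ⟨B₁, by simp [h1, s1], B₂, by simp [h2, s2], B₃, by simp [h3, s3], hne⟩
    omega
  have hpair : ∀ {α γ : Ω}, γ ≠ α → cl γ = cl α → ∀ h₁ h₂ h₃ : G,
      (∀ Δ : C, h₁ • Δ = Δ) → (∀ Δ : C, h₂ • Δ = Δ) → (∀ Δ : C, h₃ • Δ = Δ) →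
      h₁ • α = α → h₂ • α = α → h₃ • α = α →
      h₁ • γ = h₂ • γ ∨ h₁ • γ = h₃ • γ ∨ h₂ • γ = h₃ • γ := by
    intro α γ hγ hγα h₁ h₂ h₃ k₁ k₂ k₃ f₁ f₂ f₃
    obtain ⟨B, hBα, hBγ⟩ := H.exists_block_of_ne (by simp) hγ.symm
    have key : ∀ h h' : G, (∀ Δ : C, h • Δ = Δ) → (∀ Δ : C, h' • Δ = Δ) → h • α = α →
        h' • α = α → h • B = h' • B → h • γ = h' • γ := by
      intro h h' k k' f f' e
      by_contra hne
      have hα : inc α (h • B) := by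
        have := H.inc_smul h hBα
        rwa [f] at this
      have : 2 < (Finset.univ.filter fun β => inc β (h • B) ∧ cl β = cl α).card := by
        refine Finset.two_lt_card.2 ⟨α, by simp [hα], h • γ, ?_, h' • γ, ?_, ?_, ?_, hne⟩
        · simp [H.inc_smul_iff, hBγ, H.cl_smul, k, hγα]
        · simp [e, H.inc_smul_iff, hBγ, H.cl_smul, k', hγα]
        · exact fun h1 => hγ (smul_left_cancel h (h1.symm.trans f.symm))
        · exact fun h1 => hγ (smul_left_cancel h' (h1.symm.trans f'.symm))
      rw [H.card_inter hα] at this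
      omega
    have hin : ∀ h : G, h • α = α → inc α (h • B) := by
      intro h f
      have := H.inc_smul h hBα
      rwa [f] at this
    rcases hthree hBα (h₁ • B) (h₂ • B) (h₃ • B) (hin _ f₁) (hin _ f₂) (hin _ f₃)
      (H.supp_smul_of_forall k₁ B) (H.supp_smul_of_forall k₂ B) (H.supp_smul_of_forall k₃ B)
      with h | h | h
    · exact Or.inl (key _ _ k₁ k₂ f₁ f₂ h)
    · exact Or.inr (Or.inl (key _ _ k₁ k₃ f₁ f₃ h))
    · exact Or.inr (Or.inr (key _ _ k₂ k₃ f₂ f₃ h))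
  have hfix : ∀ {α γ : Ω} {h : G}, (∀ Δ : C, h • Δ = Δ) → h • α = α → cl γ = cl α →
      h • γ = γ := by
    intro α γ₀ h hk hα hγ₀
    by_contra hmove
    have hγ₀α : γ₀ ≠ α := by
      rintro rfl
      exact hmove hα
    have heven := even_card_of_matching ((Finset.univ.filter fun β => cl β = cl α).erase α)
      (fun γ γ' => (γ ≠ α ∧ cl γ = cl α) ∧ γ ≠ γ' ∧
        ∃ h : G, (∀ Δ : C, h • Δ = Δ) ∧ h • α = α ∧ h • γ = γ') ?_ ?_ ?_ ?_
    · rw [hS] at heven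
      exact absurd heven (by decide)
    · rintro a b ⟨⟨h1, h2⟩, h3, h, h4, h5, rfl⟩
      have h6 : h⁻¹ • α = α := by rw [inv_smul_eq_iff, h5]
      refine ⟨⟨fun h7 => h1 (smul_left_cancel h (h7.trans h5.symm)), ?_⟩, h3.symm, h⁻¹,
        hinv h h4, h6, by simp⟩
      rw [H.cl_smul, h4, h2]
    · rintro a ⟨-, h, -⟩
      exact h rfl
    · intro γ hγ
      rw [mem_S] at hγ
      obtain ⟨x, hx1, rfl⟩ := htr hγ₀ hγ₀α hγ.2 hγ.1
      have hx2 : x⁻¹ • α = α := by rw [inv_smul_eq_iff, hx1]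
      have h1 : (x * h * x⁻¹) • α = α := by rw [mul_smul, mul_smul, hx2, hα, hx1]
      have h2 : (x * h * x⁻¹) • x • γ₀ ≠ x • γ₀ := by
        rw [mul_smul, mul_smul, inv_smul_smul, Ne, smul_left_cancel_iff]
        exact hmove
      refine ⟨(x * h * x⁻¹) • x • γ₀, (mem_S _ _).2 ⟨?_, ?_⟩, hγ, h2.symm, _, hconj x h hk, h1,
        rfl⟩
      · exact fun h3 => hγ.1 (smul_left_cancel _ (h3.trans h1.symm))
      · rw [H.cl_smul, hconj x h hk, hγ.2]
    · rintro a b b' ⟨⟨h1, h2⟩, h3, h, h4, h5, rfl⟩ ⟨-, h3', h', h4', h5', rfl⟩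
      rcases hpair h1 h2 1 h h' (by simp) h4 h4' (by simp) h5 h5' with e | e | e
      · rw [one_smul] at e
        exact (h3 e).elim
      · rw [one_smul] at e
        exact (h3' e).elim
      · exact e
  obtain ⟨α₀, -⟩ := H.exists_moved hg1
  have : Fact (Nat.Prime 11) := ⟨by norm_num⟩
  obtain ⟨w, hw, hw11⟩ := H.exists_kernel_element htrans α₀ 11 (by simp)
  have hw1 : w ^ 11 = 1 := hw11 ▸ pow_orderOf_eq_one w
  obtain ⟨α, hα⟩ := H.exists_moved (g := w) (by rintro rfl; simp at hw11)
  have heven := even_card_of_matching ((Finset.univ.filter fun β => cl β = cl α).erase α)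
    (fun β γ => β ≠ α ∧
      ∃ h : G, (∀ Δ : C, h • Δ = Δ) ∧ h ^ 11 = 1 ∧ h • α = β ∧ h⁻¹ • α = γ) ?_ ?_ ?_ ?_
  · rw [hS] at heven
    exact absurd heven (by decide)
  · rintro β γ ⟨h1, h, h2, h3, rfl, rfl⟩
    refine ⟨?_, h⁻¹, hinv h h2, by rw [inv_pow, h3, inv_one], rfl, by simp⟩
    rw [Ne, inv_smul_eq_iff]
    exact h1.symm
  · rintro β ⟨h1, h, h2, h3, rfl, h4⟩
    apply h1
    have h5 : h ^ 2 • α = α := by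
      rw [pow_two, mul_smul, ← h4, smul_inv_smul]
    have h6 : ∀ n : ℕ, (h ^ 2) ^ n • α = α := by
      intro n
      induction n with
      | zero => simp
      | succ n ih => rw [pow_succ, mul_smul, h5, ih]
    have h7 : (h ^ 2) ^ 6 = h := by
      rw [← pow_mul, show 2 * 6 = 11 + 1 from rfl, pow_succ, h3, one_mul]
    rw [← h7, h6]
  · intro β hβ
    rw [mem_S] at hβ
    obtain ⟨x, hx1, rfl⟩ := htr (by rw [H.cl_smul, hw]) hα hβ.2 hβ.1
    have hx2 : x⁻¹ • α = α := by rw [inv_smul_eq_iff, hx1]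
    have h1 : (x * w * x⁻¹) • α = x • w • α := by rw [mul_smul, mul_smul, hx2]
    refine ⟨(x * w * x⁻¹)⁻¹ • α, (mem_S _ _).2 ⟨?_, ?_⟩, hβ.1, x * w * x⁻¹, hconj x w hw, ?_, h1,
      rfl⟩
    · rw [Ne, inv_smul_eq_iff, h1]
      exact hβ.1.symm
    · rw [H.cl_smul, hinv _ (hconj x w hw)]
    · rw [conj_pow, hw1, mul_one, mul_inv_cancel]
  · rintro β γ γ' ⟨h1, h, h2, h3, rfl, rfl⟩ ⟨-, h', h2', h3', h4, rfl⟩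
    have h5 : (h⁻¹ * h') • (h'⁻¹ • α) = h'⁻¹ • α := by
      refine hfix (α := α) ?_ ?_ ?_
      · intro Δ
        rw [mul_smul, h2', hinv h h2]
      · rw [mul_smul, h4, inv_smul_smul]
      · rw [H.cl_smul, hinv h' h2']
    rwa [mul_smul, smul_inv_smul] at h5

theorem card_dvd_card_group (H : ImprimitiveDesign G cl inc lam v k c d ℓ) (hk : 0 < k) (B : 𝔅) :
    Fintype.card 𝔅 ∣ Nat.card G := by
  have h := card_dvd_card_subgroup (⊤ : Subgroup G) (Finset.univ : Finset 𝔅) B ?_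
  · rwa [Finset.card_univ, Subgroup.card_top] at h
  · intro D
    simpa using H.exists_smul_block hk B D

theorem smul_class_ne {g : G} (hK : ∀ g : G, (∀ Δ : C, g • Δ = Δ) → g = 1) (hg : g ≠ 1) :
    (Finset.univ.filter fun Δ : C => g • Δ = Δ).card ≠ Fintype.card C := by
  intro h
  rw [← Finset.card_univ, Finset.card_filter_eq_iff] at h
  exact hg (hK g fun Δ => h Δ (Finset.mem_univ Δ))

theorem false₂ [Finite G] (H : ImprimitiveDesign G cl inc 4 231 24 21 11 3) : False := by
  have N := H.counts₂
  have hK := H.kernel_trivial₂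
  obtain ⟨B⟩ : Nonempty 𝔅 := by
    rw [← Fintype.card_pos_iff, N.blocks]
    simp
  have hd := H.card_dvd_card_group (by simp) B
  rw [N.blocks] at hd
  have : Fact (Nat.Prime 7) := ⟨by norm_num⟩
  obtain ⟨w, hw⟩ := exists_prime_orderOf_dvd_card' (G := G) 7 (dvd_trans (by norm_num) hd)
  have hw1 : w ^ 7 = 1 := hw ▸ pow_orderOf_eq_one w
  have hfix := card_modEq_card_fixed_of_pow hw1 (Finset.univ : Finset C) (by simp)
  have hne := smul_class_ne hK (g := w) (by rintro rfl; simp at hw)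
  have hsum := Finset.card_filter_add_card_filter_not (s := (Finset.univ : Finset C))
    fun Δ => w • Δ = Δ
  rw [Finset.card_univ, H.card_class] at hsum hfix
  rw [H.card_class] at hne
  have hmov : (Finset.univ.filter fun Δ : C => w • Δ ≠ Δ).card = 7 := by
    unfold Nat.ModEq at hfix
    simp only [Ne] at hsum ⊢
    omega
  have h := H.choose_dvd_card N (by simp) (by simp) fun S T hS hT =>
    exists_smul_finset_eq_of_compl
      (H.two_transitive N.through N.through_meeting (by simp) (by simp) (by intro n; omega))
      (p := 7) (by norm_num) hw1 hmov (by rw [H.card_class]; simp) (by simp) hS hT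
  exact absurd h (by decide)

theorem false₃ [Finite G] (H : ImprimitiveDesign G cl inc 4 484 24 22 22 2) : False := by
  have N := H.counts₃
  have hK := H.kernel_trivial₃
  have h2 := H.two_transitive N.through N.through_meeting (by simp) (by simp)
    (by intro n; omega)
  obtain ⟨α⟩ : Nonempty Ω := by
    rw [← Fintype.card_pos_iff, H.card_point]
    simp
  have hd : 22 ∣ Nat.card (stabilizer G (cl α)) := by
    have h := card_dvd_card_subgroup (stabilizer G (cl α))
      (Finset.univ.filter fun β => cl β = cl α) α ?_
    · rwa [H.card_fiber] at h
    · intro β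
      simp only [Finset.mem_filter, Finset.mem_univ, true_and, mem_stabilizer_iff]
      constructor
      · intro h
        obtain ⟨g, rfl⟩ := H.exists_smul_point N.through (by simp) α β
        exact ⟨g, by rwa [← H.cl_smul], rfl⟩
      · rintro ⟨g, h, rfl⟩
        rw [H.cl_smul, h]
  have : Fact (Nat.Prime 11) := ⟨by norm_num⟩
  obtain ⟨w', hw'⟩ := exists_prime_orderOf_dvd_card' (G := stabilizer G (cl α)) 11
    (dvd_trans (by norm_num) hd)
  obtain ⟨w, hw, hwα⟩ : ∃ w : G, orderOf w = 11 ∧ w • cl α = cl α :=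
    ⟨w', by rwa [Subgroup.orderOf_coe], w'.2⟩
  have hw1 : w ^ 11 = 1 := hw ▸ pow_orderOf_eq_one w
  have hfix := card_modEq_card_fixed_of_pow hw1 (Finset.univ : Finset C) (by simp)
  have hne := smul_class_ne hK (g := w) (by rintro rfl; simp at hw)
  have hpos : 0 < (Finset.univ.filter fun Δ : C => w • Δ = Δ).card :=
    Finset.card_pos.2 ⟨cl α, by simpa using hwα⟩
  have hsum := Finset.card_filter_add_card_filter_not (s := (Finset.univ : Finset C))
    fun Δ => w • Δ = Δ
  rw [Finset.card_univ, H.card_class] at hsum hfix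
  rw [H.card_class] at hne
  have hmov : (Finset.univ.filter fun Δ : C => w • Δ ≠ Δ).card = 11 := by
    unfold Nat.ModEq at hfix
    simp only [Ne] at hsum ⊢
    omega
  have h := H.choose_dvd_card N (by simp) (by simp) fun S T hS hT =>
    exists_smul_finset_eq h2 (p := 11) (by norm_num) hw1 hmov (by rw [H.card_class]; simp)
      (by rw [H.card_class]) hS hT
  exact absurd h (by decide)

end

end ImprimitiveDesign

theorem mod_seven_eq_one {m : ℕ} (h8 : m ∣ 8) (h3 : m % 7 ∣ 3) : m % 7 = 1 := by
  have := Nat.le_of_dvd (by simp) h8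
  interval_cases m <;> revert h8 h3 <;> decide

section

open scoped Classical

variable {G X : Type*} [Group G] [MulAction G X]

theorem smul_eq_of_card_lt [Finite G] {p : ℕ} [Fact p.Prime] {w : G} (hw : w ^ p = 1)
    (S : Finset X) (hS : ∀ x ∈ S, w • x ∈ S) (hp : S.card < p) {x : X} (hx : x ∈ S) :
    w • x = x := by
  have h := card_modEq_card_fixed_of_pow hw S hS
  have hle := Finset.card_filter_le S fun x => w • x = x
  have heq := h.eq_of_lt_of_lt hp (hle.trans_lt hp)
  exact (Finset.card_filter_eq_iff.1 heq.symm) x hx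

end

namespace ImprimitiveDesign

section

open scoped Classical

variable {G Ω C 𝔅 : Type*} [Group G] [Fintype Ω] [Fintype C]
    [Fintype 𝔅] [MulAction G Ω] [MulAction G C] [MulAction G 𝔅] {cl : Ω → C}
    {inc : Ω → 𝔅 → Prop} {lam v k c d ℓ : ℕ}

theorem not_seven_dvd_card [Finite G] (H : ImprimitiveDesign G cl inc 3 256 18 16 16 2) :
    ¬ 7 ∣ Nat.card G := by
  intro h7
  have N := H.counts₁
  have hK := H.kernel_trivial₁
  have : Fact (Nat.Prime 7) := ⟨by norm_num⟩
  obtain ⟨w, hw⟩ := exists_prime_orderOf_dvd_card' (G := G) 7 h7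
  have hw1 : w ^ 7 = 1 := hw ▸ pow_orderOf_eq_one w
  have hfix := card_modEq_card_fixed_of_pow hw1 (Finset.univ : Finset C) (by simp)
  have hne := smul_class_ne hK (g := w) (by rintro rfl; simp at hw)
  have hsum := Finset.card_filter_add_card_filter_not (s := (Finset.univ : Finset C))
    fun Δ => w • Δ = Δ
  rw [Finset.card_univ, H.card_class] at hsum hfix
  rw [H.card_class] at hne
  have hcard : (Finset.univ.filter fun Δ : C => w • Δ = Δ).card = 2 := by
    by_contra hcon
    have hmov : (Finset.univ.filter fun Δ : C => w • Δ ≠ Δ).card = 7 := by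
      unfold Nat.ModEq at hfix
      simp only [Ne] at hsum ⊢
      omega
    have h := H.choose_dvd_card N (by simp) (by simp) fun S T hS hT =>
      exists_smul_finset_eq
        (H.two_transitive N.through N.through_meeting (by simp) (by simp) (by intro n; omega))
        (p := 7) (by norm_num) hw1 hmov (by rw [H.card_class]; simp)
        (by rw [H.card_class]; simp) hS hT
    exact absurd h (by decide)
  have hblock : ∀ {α β : Ω} {B : 𝔅}, w • α = α → w • β = β → α ≠ β → inc α B → inc β B →
      w • B = B := by
    intro α β B hα hβ hαβ h1 h2
    refine smul_eq_of_card_lt hw1 (Finset.univ.filter fun B => inc α B ∧ inc β B) ?_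
      (by rw [H.card_pair hαβ]; simp) (by simp [h1, h2])
    intro D hD
    simp only [Finset.mem_filter, Finset.mem_univ, true_and] at hD ⊢
    exact ⟨by simpa [hα] using H.inc_smul w hD.1, by simpa [hβ] using H.inc_smul w hD.2⟩
  have hsuppw : ∀ {B : 𝔅}, w • B = B → ∀ Δ ∈ supp cl inc B, w • Δ ∈ supp cl inc B := by
    intro B hB Δ hΔ
    simpa [hB] using (H.smul_mem_supp w).2 hΔ
  have hsupp : ∀ {B : 𝔅}, w • B = B → ∀ Δ : C, w • Δ = Δ → Δ ∈ supp cl inc B := by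
    intro B hB Δ hΔ
    have h := card_modEq_card_fixed_of_pow hw1 (supp cl inc B) (hsuppw hB)
    have hsub : ((supp cl inc B).filter fun Δ => w • Δ = Δ) ⊆
        Finset.univ.filter fun Δ : C => w • Δ = Δ :=
      Finset.filter_subset_filter _ (Finset.subset_univ _)
    have hle := Finset.card_le_card hsub
    rw [N.support] at h
    have heq := Finset.eq_of_subset_of_card_le hsub (by
      unfold Nat.ModEq at h
      omega)
    have : Δ ∈ Finset.univ.filter fun Δ : C => w • Δ = Δ := by simpa using hΔ
    rw [← heq] at this
    exact (Finset.mem_filter.1 this).1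
  have hpoint : ∀ {B : 𝔅} {α : Ω}, w • B = B → w • cl α = cl α → inc α B → w • α = α := by
    intro B α hB hα h
    refine smul_eq_of_card_lt hw1 (Finset.univ.filter fun β => inc β B ∧ cl β = cl α) ?_
      (by rw [H.card_inter h]; simp) (by simp [h])
    intro β hβ
    simp only [Finset.mem_filter, Finset.mem_univ, true_and] at hβ ⊢
    exact ⟨by simpa [hB] using H.inc_smul w hβ.1, by rw [H.cl_smul, hβ.2, hα]⟩
  have hfixed : ∀ Δ : C, w • Δ = Δ →
      16 ≡ (Finset.univ.filter fun β => cl β = Δ ∧ w • β = β).card [MOD 7] := by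
    intro Δ hΔ
    have h := card_modEq_card_fixed_of_pow hw1 (Finset.univ.filter fun β => cl β = Δ) (by
      intro β hβ
      simp only [Finset.mem_filter, Finset.mem_univ, true_and] at hβ ⊢
      rw [H.cl_smul, hβ, hΔ])
    rwa [H.card_fiber, Finset.filter_filter] at h
  have hcount : ∀ Δ Δ' : C, w • Δ = Δ → w • Δ' = Δ' → Δ ≠ Δ' →
      (Finset.univ.filter fun β => cl β = Δ' ∧ w • β = β).card =
        2 * ((Finset.univ.filter fun β => cl β = Δ ∧ w • β = β).card - 1) := by
    intro Δ Δ' hΔ hΔ' hΔΔ'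
    obtain ⟨α, hα⟩ : (Finset.univ.filter fun β => cl β = Δ ∧ w • β = β).Nonempty := by
      rw [← Finset.card_pos]
      have := hfixed Δ hΔ
      unfold Nat.ModEq at this
      omega
    simp only [Finset.mem_filter, Finset.mem_univ, true_and] at hα
    obtain ⟨rfl, hα⟩ := hα
    have h1 := Finset.card_mul_eq_card_mul (s := Finset.univ.filter fun B => inc α B ∧ w • B = B)
      (t := (Finset.univ.filter fun β => cl β = cl α ∧ w • β = β).erase α)
      (fun B β => inc β B) (m := 1) (n := 3) ?_ ?_
    · have h2 := Finset.card_mul_eq_card_mul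
        (s := Finset.univ.filter fun B => inc α B ∧ w • B = B)
        (t := Finset.univ.filter fun β => cl β = Δ' ∧ w • β = β)
        (fun B β => inc β B) (m := 2) (n := 3) ?_ ?_
      · rw [Finset.card_erase_of_mem (by simp [hα])] at h1
        omega
      · intro B hB
        simp only [Finset.mem_filter, Finset.mem_univ, true_and] at hB
        rw [← H.card_inter_of_mem_supp (hsupp hB.2 Δ' hΔ')]
        congr 1
        ext β
        simp only [Finset.mem_bipartiteAbove, Finset.mem_filter, Finset.mem_univ, true_and]
        constructor
        · rintro ⟨⟨h3, -⟩, h4⟩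
          exact ⟨h4, h3⟩
        · rintro ⟨h4, rfl⟩
          exact ⟨⟨rfl, hpoint hB.2 hΔ' h4⟩, h4⟩
      · intro β hβ
        simp only [Finset.mem_filter, Finset.mem_univ, true_and] at hβ
        have hne : α ≠ β := by
          rintro rfl
          exact hΔΔ' hβ.1
        rw [← H.card_pair hne]
        congr 1
        ext B
        simp only [Finset.mem_bipartiteBelow, Finset.mem_filter, Finset.mem_univ, true_and]
        constructor
        · rintro ⟨⟨h3, -⟩, h4⟩
          exact ⟨h3, h4⟩
        · rintro ⟨h3, h4⟩
          exact ⟨⟨h3, hblock hα hβ.2 hne h3 h4⟩, h4⟩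
    · intro B hB
      simp only [Finset.mem_filter, Finset.mem_univ, true_and] at hB
      have := Finset.card_erase_of_mem (a := α)
        (s := Finset.univ.filter fun β => inc β B ∧ cl β = cl α) (by simp [hB.1])
      rw [H.card_inter hB.1] at this
      refine Eq.trans ?_ this
      congr 1
      ext β
      simp only [Finset.mem_bipartiteAbove, Finset.mem_filter, Finset.mem_univ, true_and,
        Finset.mem_erase]
      constructor
      · rintro ⟨⟨h5, h3, -⟩, h4⟩
        exact ⟨h5, h4, h3⟩
      · rintro ⟨h5, h4, h3⟩
        exact ⟨⟨h5, h3, hpoint hB.2 (by rw [h3, hΔ]) h4⟩, h4⟩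
    · intro β hβ
      simp only [Finset.mem_filter, Finset.mem_univ, true_and, Finset.mem_erase] at hβ
      rw [← H.card_pair hβ.1.symm]
      congr 1
      ext B
      simp only [Finset.mem_bipartiteBelow, Finset.mem_filter, Finset.mem_univ, true_and]
      constructor
      · rintro ⟨⟨h3, -⟩, h4⟩
        exact ⟨h3, h4⟩
      · rintro ⟨h3, h4⟩
        exact ⟨⟨h3, hblock hα hβ.2.2 hβ.1.symm h3 h4⟩, h4⟩
  obtain ⟨Δ, Δ', hΔΔ', hset⟩ := Finset.card_eq_two.1 hcard
  have hmem : ∀ Θ : C, w • Θ = Θ ↔ Θ = Δ ∨ Θ = Δ' := by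
    intro Θ
    have : Θ ∈ (Finset.univ.filter fun Δ : C => w • Δ = Δ) ↔ Θ ∈ ({Δ, Δ'} : Finset C) := by
      rw [hset]
    simpa using this
  have hΔ : w • Δ = Δ := (hmem Δ).2 (Or.inl rfl)
  have hΔ' : w • Δ' = Δ' := (hmem Δ').2 (Or.inr rfl)
  have htwo : (Finset.univ.filter fun β => cl β = Δ ∧ w • β = β).card = 2 := by
    have h1 := hcount Δ Δ' hΔ hΔ' hΔΔ'
    have h2 := hcount Δ' Δ hΔ' hΔ hΔΔ'.symm
    have h3 := hfixed Δ hΔ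
    unfold Nat.ModEq at h3
    omega
  obtain ⟨α, β, hαβ, hset2⟩ := Finset.card_eq_two.1 htwo
  have hmem2 : ∀ γ : Ω, cl γ = Δ ∧ w • γ = γ ↔ γ = α ∨ γ = β := by
    intro γ
    have : γ ∈ (Finset.univ.filter fun β => cl β = Δ ∧ w • β = β) ↔
        γ ∈ ({α, β} : Finset Ω) := by
      rw [hset2]
    simpa using this
  have hα := (hmem2 α).2 (Or.inl rfl)
  have hβ := (hmem2 β).2 (Or.inr rfl)
  obtain ⟨μ, hμ⟩ := H.exists_card_supp_eq (by simp)
  have hμ8 : μ ∣ 8 := N.dvd_gcd H (by simp) hμ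
  obtain ⟨B₁, B₂, B₃, h12, h13, h23, hset3⟩ := Finset.card_eq_three.1 (H.card_pair hαβ)
  have hfixB : ∀ B : 𝔅, w • B = B ↔ B = B₁ ∨ B = B₂ ∨ B = B₃ := by
    intro B
    have hB : B ∈ (Finset.univ.filter fun B => inc α B ∧ inc β B) ↔
        B ∈ ({B₁, B₂, B₃} : Finset 𝔅) := by
      rw [hset3]
    simp only [Finset.mem_filter, Finset.mem_univ, true_and, Finset.mem_insert,
      Finset.mem_singleton] at hB
    rw [← hB]
    constructor
    · intro h
      have hΔB := hsupp h Δ hΔ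
      have hcB := H.card_inter_of_mem_supp hΔB
      have hsub : (Finset.univ.filter fun γ => inc γ B ∧ cl γ = Δ) ⊆
          Finset.univ.filter fun γ => cl γ = Δ ∧ w • γ = γ := by
        intro γ
        simp only [Finset.mem_filter, Finset.mem_univ, true_and]
        rintro ⟨h1, rfl⟩
        exact ⟨rfl, hpoint h hΔ h1⟩
      have heq := Finset.eq_of_subset_of_card_le hsub (by rw [hcB, htwo])
      have h1 : ∀ γ, cl γ = Δ ∧ w • γ = γ → inc γ B := by
        intro γ hγ
        have : γ ∈ Finset.univ.filter fun γ => cl γ = Δ ∧ w • γ = γ := by simpa using hγ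
        rw [← heq] at this
        exact (Finset.mem_filter.1 this).2.1
      exact ⟨h1 α hα, h1 β hβ⟩
    · rintro ⟨h1, h2⟩
      exact hblock hα.2 hβ.2 hαβ h1 h2
  have hpart : ∀ {B : 𝔅}, w • B = B → μ ≡
      (({B₁, B₂, B₃} : Finset 𝔅).filter fun D => supp cl inc D = supp cl inc B).card [MOD 7] := by
    intro B hB
    have h := card_modEq_card_fixed_of_pow hw1
      (Finset.univ.filter fun D => supp cl inc D = supp cl inc B) (by
        intro D hD
        simp only [Finset.mem_filter, Finset.mem_univ, true_and] at hD ⊢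
        rw [← H.supp_smul_eq_iff w, hB] at hD
        exact hD)
    rw [hμ] at h
    convert h using 2
    ext D
    simp only [Finset.mem_filter, Finset.mem_univ, true_and, hfixB, Finset.mem_insert,
      Finset.mem_singleton]
    tauto
  have hseven : ∀ {B : 𝔅}, w • B = B → ((supp cl inc B).filter fun Δ => w • Δ ≠ Δ).card = 7 := by
    intro B hB
    have h := Finset.card_filter_add_card_filter_not (s := supp cl inc B) fun Δ => w • Δ = Δ
    have h1 : ((supp cl inc B).filter fun Δ => w • Δ = Δ) =
        Finset.univ.filter fun Δ : C => w • Δ = Δ := by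
      ext Θ
      simpa using hsupp hB Θ
    rw [h1, hcard, N.support] at h
    simp only [Ne]
    omega
  have hdisj : ∀ {B D : 𝔅}, w • B = B → w • D = D → supp cl inc B ≠ supp cl inc D →
      Disjoint ((supp cl inc B).filter fun Δ => w • Δ ≠ Δ)
        ((supp cl inc D).filter fun Δ => w • Δ ≠ Δ) := by
    intro B D hB hD hne
    by_contra hnd
    set U := (supp cl inc B).filter fun Δ => w • Δ ≠ Δ with hU
    set V := (supp cl inc D).filter fun Δ => w • Δ ≠ Δ with hV
    have hpos : 0 < (U ∩ V).card := by
      rwa [Finset.card_pos, Finset.nonempty_iff_ne_empty, Ne, ← Finset.disjoint_iff_inter_eq_empty]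
    have h := card_modEq_card_fixed_of_pow hw1 (U ∩ V) (by
      intro Θ hΘ
      simp only [hU, hV, Finset.mem_inter, Finset.mem_filter, Ne, smul_left_cancel_iff] at hΘ ⊢
      exact ⟨⟨hsuppw hB _ hΘ.1.1, hΘ.1.2⟩, hsuppw hD _ hΘ.2.1, hΘ.2.2⟩)
    have h0 : ((U ∩ V).filter fun Δ => w • Δ = Δ) = ∅ := by
      rw [Finset.filter_eq_empty_iff]
      intro Θ hΘ
      exact (Finset.mem_filter.1 (Finset.mem_inter.1 hΘ).1).2
    rw [h0, Finset.card_empty] at h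
    have hle : 7 ≤ (U ∩ V).card := Nat.le_of_dvd hpos ((Nat.modEq_zero_iff_dvd).1 h)
    have hUV : U = V :=
      (Finset.eq_of_subset_of_card_le Finset.inter_subset_left (by rwa [hseven hB])).symm.trans
        (Finset.eq_of_subset_of_card_le Finset.inter_subset_right (by rwa [hseven hD]))
    apply hne
    ext Θ
    by_cases hΘ : w • Θ = Θ
    · exact iff_of_true (hsupp hB Θ hΘ) (hsupp hD Θ hΘ)
    · have : Θ ∈ U ↔ Θ ∈ V := by rw [hUV]
      simpa [hU, hV, hΘ] using this
  set 𝓕 : Finset 𝔅 := {B₁, B₂, B₃} with h𝓕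
  have h𝓕card : 𝓕.card = 3 := Finset.card_eq_three.2 ⟨B₁, B₂, B₃, h12, h13, h23, rfl⟩
  have hfix𝓕 : ∀ {B}, B ∈ 𝓕 → w • B = B := fun h => (hfixB _).2 (by simpa [h𝓕] using h)
  have hle : ∀ B, (𝓕.filter fun D => supp cl inc D = supp cl inc B).card ≤ 3 :=
    fun B => h𝓕card ▸ Finset.card_filter_le _ _
  have hμ2 : ∀ {B}, B ∈ 𝓕 →
      (𝓕.filter fun D => supp cl inc D = supp cl inc B).card = μ % 7 := by
    intro B hB
    have h1 := hpart (hfix𝓕 hB)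
    have h2 := hle B
    unfold Nat.ModEq at h1
    omega
  have hthree := Finset.card_eq_sum_card_image (supp cl inc) 𝓕
  rw [Finset.sum_const_nat (m := μ % 7) (by
    intro S hS
    obtain ⟨B, hB, rfl⟩ := Finset.mem_image.1 hS
    exact hμ2 hB), h𝓕card] at hthree
  have hone : μ % 7 = 1 := mod_seven_eq_one hμ8 ⟨_, hthree.trans (mul_comm _ _)⟩
  have hinj : ∀ {B D}, B ∈ 𝓕 → D ∈ 𝓕 → B ≠ D → supp cl inc B ≠ supp cl inc D := by
    intro B D hB hD hne h
    have h1 := hμ2 hB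
    rw [hone, Finset.card_eq_one] at h1
    obtain ⟨E, hE⟩ := h1
    have h2 : B ∈ ({E} : Finset 𝔅) := by rw [← hE]; simp [hB]
    have h3 : D ∈ ({E} : Finset 𝔅) := by rw [← hE]; simp [hD, h]
    rw [Finset.mem_singleton] at h2 h3
    exact hne (h2.trans h3.symm)
  have hunion := Finset.card_biUnion (s := 𝓕)
    (t := fun B => (supp cl inc B).filter fun Δ => w • Δ ≠ Δ)
    fun B hB D hD hne => hdisj (hfix𝓕 hB) (hfix𝓕 hD) (hinj hB hD hne)
  rw [Finset.sum_const_nat fun B hB => hseven (hfix𝓕 hB), h𝓕card] at hunion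
  have hlast := Finset.card_le_univ
    (𝓕.biUnion fun B => (supp cl inc B).filter fun Δ => w • Δ ≠ Δ)
  rw [H.card_class] at hlast
  omega

end

end ImprimitiveDesign

section

open scoped Classical

variable {X : Type*}

theorem apply_eq_of_card_le {f : X → X} (hf : Function.Injective f) (S F : Finset X)
    (hS : ∀ x ∈ S, f x ∈ S) (hF : ∀ x ∈ F, x ∈ S ∧ f x = x) (hcard : S.card ≤ F.card + 1)
    {x : X} (hx : x ∈ S) : f x = x := by
  by_contra h
  have hsub : insert x (insert (f x) F) ⊆ S := by
    intro y hy
    simp only [Finset.mem_insert] at hy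
    rcases hy with rfl | rfl | hy
    · exact hx
    · exact hS x hx
    · exact (hF y hy).1
  have h1 : f x ∉ F := fun h' => h (hf (hF _ h').2)
  have h2 : x ∉ insert (f x) F := by
    rw [Finset.mem_insert, not_or]
    exact ⟨fun h' => h h'.symm, fun h' => h (hF x h').2⟩
  have := Finset.card_le_card hsub
  rw [Finset.card_insert_of_notMem h2, Finset.card_insert_of_notMem h1] at this
  omega

theorem exists_apply_eq {f : X → X} (hf : Function.Injective f) {S T : Finset X}
    (hS : ∀ x ∈ S, f x ∈ T) (hcard : T.card ≤ S.card) {y : X} (hy : y ∈ T) :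
    ∃ x ∈ S, f x = y := by
  have : S.image f = T := by
    refine Finset.eq_of_subset_of_card_le ?_ ?_
    · intro t ht
      obtain ⟨x, hx, rfl⟩ := Finset.mem_image.1 ht
      exact hS x hx
    · rwa [Finset.card_image_of_injective _ hf]
  rw [← this] at hy
  simpa using hy

/-- The neighbourhood function of a strongly regular graph with parameters `(n, 6, 1, 3)` on the
vertex set `V`. -/
structure IsQuadrangle (V : Finset X) (N : X → Finset X) : Prop where
  mem : ∀ {x y}, y ∈ N x → y ∈ V
  symm : ∀ {x y}, y ∈ N x → x ∈ N y
  irrefl : ∀ x, x ∉ N x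
  degree : ∀ {x}, x ∈ V → (N x).card = 6
  adj : ∀ {x y}, y ∈ N x → (N x ∩ N y).card = 1
  nonadj : ∀ {x y}, x ∈ V → y ∈ V → x ≠ y → y ∉ N x → (N x ∩ N y).card = 3

namespace IsQuadrangle

variable {V : Finset X} {N : X → Finset X}

theorem notMem_of_common (Q : IsQuadrangle V N) {x y a b : X} (hab : a ≠ b) (ha : a ∈ N x)
    (ha' : a ∈ N y) (hb : b ∈ N x) (hb' : b ∈ N y) : y ∉ N x := fun h =>
  hab (Finset.card_le_one.1 (Q.adj h).le a (by simp [ha, ha']) b (by simp [hb, hb']))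

theorem apply_eq_of_mem (Q : IsQuadrangle V N) {f : X → X} (hf : Function.Injective f)
    (hN : ∀ {x y}, y ∈ N x → f y ∈ N (f x)) {a u v w : X} (ha : f a = a)
    (hu : f u = u) (hv : f v = v) (hw : f w = w) (hau : u ∈ N a) (hav : v ∈ N a) (haw : w ∈ N a)
    (huv : u ≠ v) (huw : u ≠ w) (hvw : v ≠ w) (nuv : v ∉ N u) (nuw : w ∉ N u) (nvw : w ∉ N v)
    {x : X} (hx : x ∈ N a) : f x = x := by
  have key : ∀ {y}, y ∈ N a → f y = y → ∃ t, t ∈ N a ∧ t ∈ N y ∧ f t = t := by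
    intro y hy hfy
    obtain ⟨t, ht⟩ := Finset.card_eq_one.1 (Q.adj hy)
    have ht' : t ∈ N a ∩ N y := by rw [ht]; simp
    refine ⟨t, (Finset.mem_inter.1 ht').1, (Finset.mem_inter.1 ht').2, ?_⟩
    refine apply_eq_of_card_le hf (N a ∩ N y) ∅ ?_ (by simp) (by rw [ht]; simp) ht'
    intro s hs
    rw [Finset.mem_inter] at hs ⊢
    exact ⟨by simpa [ha] using hN hs.1, by simpa [hfy] using hN hs.2⟩
  obtain ⟨s, hs, hsu, hfs⟩ := key hau hu
  obtain ⟨t, ht, htv, hft⟩ := key hav hv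
  have hst : s ≠ t := by
    rintro rfl
    exact Q.notMem_of_common huv hau (Q.symm hsu) hav (Q.symm htv) hs
  have h1 : s ≠ u := by rintro rfl; exact Q.irrefl _ hsu
  have h2 : s ≠ v := by rintro rfl; exact nuv hsu
  have h3 : s ≠ w := by rintro rfl; exact nuw hsu
  have h4 : t ≠ v := by rintro rfl; exact Q.irrefl _ htv
  have h5 : t ≠ u := by rintro rfl; exact nuv (Q.symm htv)
  have h6 : t ≠ w := by rintro rfl; exact nvw htv
  refine apply_eq_of_card_le hf (N a) {u, v, w, s, t} ?_ ?_ ?_ hx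
  · intro y hy
    simpa [ha] using hN hy
  · intro y hy
    simp only [Finset.mem_insert, Finset.mem_singleton] at hy
    rcases hy with rfl | rfl | rfl | rfl | rfl <;> constructor <;> assumption
  · rw [Q.degree (Q.mem (Q.symm hau))]
    rw [Finset.card_insert_of_notMem, Finset.card_insert_of_notMem, Finset.card_insert_of_notMem,
      Finset.card_pair hst]
    · simp [h3.symm, h6.symm]
    · simp [hvw, h2.symm, h4.symm]
    · simp [huv, huw, h1.symm, h5.symm]

/-- An automorphism fixing two opposite vertices and two of their common neighbours is trivial. -/
theorem apply_eq (Q : IsQuadrangle V N) {f : X → X} (hf : Function.Injective f)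
    (hfV : ∀ x ∈ V, f x ∈ V) (hN : ∀ {x y}, y ∈ N x → f y ∈ N (f x)) {q z a b : X}
    (hq : f q = q) (hz : f z = z) (ha : f a = a) (hb : f b = b) (hqz : q ≠ z) (nqz : z ∉ N q)
    (haq : a ∈ N q) (haz : a ∈ N z) (hbq : b ∈ N q) (hbz : b ∈ N z) (hab : a ≠ b) {x : X}
    (hx : x ∈ V) : f x = x := by
  have hinter : ∀ {u v s t x : X}, f u = u → f v = v → f s = s → f t = t → u ∈ V → v ∈ V →
      u ≠ v → v ∉ N u → s ∈ N u ∩ N v → t ∈ N u ∩ N v → s ≠ t → x ∈ N u ∩ N v → f x = x := by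
    intro u v s t x hu hv hs ht huV hvV huv nuv hs' ht' hst hx
    refine apply_eq_of_card_le hf (N u ∩ N v) {s, t} ?_ ?_ ?_ hx
    · intro y hy
      rw [Finset.mem_inter] at hy ⊢
      exact ⟨by simpa [hu] using hN hy.1, by simpa [hv] using hN hy.2⟩
    · intro y hy
      simp only [Finset.mem_insert, Finset.mem_singleton] at hy
      rcases hy with rfl | rfl
      · exact ⟨hs', hs⟩
      · exact ⟨ht', ht⟩
    · rw [Q.nonadj huV hvV huv nuv, Finset.card_pair hst]
  have hqV := Q.mem (Q.symm haq)
  have hzV := Q.mem (Q.symm haz)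
  have haV := Q.mem haq
  have hbV := Q.mem hbq
  have nab : b ∉ N a :=
    Q.notMem_of_common hqz (Q.symm haq) (Q.symm hbq) (Q.symm haz) (Q.symm hbz)
  have hqab : q ∈ N a ∩ N b := by simp [Q.symm haq, Q.symm hbq]
  have hzab : z ∈ N a ∩ N b := by simp [Q.symm haz, Q.symm hbz]
  have hcard := Q.nonadj haV hbV hab nab
  obtain ⟨y, hy, hyq, hyz⟩ : ∃ y ∈ N a ∩ N b, y ≠ q ∧ y ≠ z := by
    have : ((N a ∩ N b) \ {q, z}).Nonempty := by
      rw [← Finset.card_pos, Finset.card_sdiff_of_subset (by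
        simp [Finset.insert_subset_iff, hqab, hzab]), Finset.card_pair hqz, hcard]
      simp
    obtain ⟨y, hy⟩ := this
    simp only [Finset.mem_sdiff, Finset.mem_insert, Finset.mem_singleton, not_or] at hy
    exact ⟨y, hy.1, hy.2⟩
  have hfy : f y = y := hinter ha hb hq hz haV hbV hab nab hqab hzab hqz hy
  rw [Finset.mem_inter] at hy
  have nqy : y ∉ N q := Q.notMem_of_common hab haq (Q.symm hy.1) hbq (Q.symm hy.2)
  have nzy : y ∉ N z := Q.notMem_of_common hab haz (Q.symm hy.1) hbz (Q.symm hy.2)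
  have hNa : ∀ {x}, x ∈ N a → f x = x := fun hx =>
    Q.apply_eq_of_mem hf hN ha hq hz hfy (Q.symm haq) (Q.symm haz) hy.1 hqz hyq.symm hyz.symm nqz
      nqy nzy hx
  have hNb : ∀ {x}, x ∈ N b → f x = x := fun hx =>
    Q.apply_eq_of_mem hf hN hb hq hz hfy (Q.symm hbq) (Q.symm hbz) hy.2 hqz hyq.symm hyz.symm nqz
      nqy nzy hx
  by_contra hne
  have hxa : x ≠ a := by rintro rfl; exact hne ha
  have hxb : x ≠ b := by rintro rfl; exact hne hb
  have nxa : a ∉ N x := fun h => hne (hNa (Q.symm h))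
  have nxb : b ∉ N x := fun h => hne (hNb (Q.symm h))
  have hsub : ∀ {u}, (∀ {x}, x ∈ N u → f x = x) → N x ∩ N u ⊆ N x ∩ N (f x) := by
    intro u hu y hy
    rw [Finset.mem_inter] at hy ⊢
    refine ⟨hy.1, ?_⟩
    have := hN (Q.symm hy.1)
    rw [hu hy.2] at this
    exact Q.symm this
  have h3a := Q.nonadj hx haV hxa nxa
  have h3b := Q.nonadj hx hbV hxb nxb
  have hna := Finset.card_le_card (hsub hNa)
  have hnonadj : f x ∉ N x := fun h => by
    have := Q.adj h
    omega
  have h3 := Q.nonadj hx (hfV x hx) (Ne.symm hne) hnonadj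
  have heqa := Finset.eq_of_subset_of_card_le (hsub hNa) (by omega)
  have heqb := Finset.eq_of_subset_of_card_le (hsub hNb) (by omega)
  have hsub' : N x ∩ N a ⊆ N a ∩ N b := by
    intro y hy
    have hy' := hy
    rw [heqa, ← heqb] at hy'
    exact Finset.mem_inter.2 ⟨(Finset.mem_inter.1 hy).2, (Finset.mem_inter.1 hy').2⟩
  have heq := Finset.eq_of_subset_of_card_le hsub' (by omega)
  rw [← heq, Finset.mem_inter] at hqab hzab
  exact hne (hinter hq hz ha hb hqV hzV hqz nqz (by simp [haq, haz]) (by simp [hbq, hbz]) hab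
    (by simp [Q.symm hqab.1, Q.symm hzab.1]))

end IsQuadrangle

/-- The function sending two points of an affine plane of order four to the line through them. -/
structure IsPlane [Fintype X] (ln : X → X → Finset X) : Prop where
  card_point : Fintype.card X = 16
  card_line : ∀ {a b}, a ≠ b → (ln a b).card = 4
  left_mem : ∀ {a b}, a ≠ b → a ∈ ln a b
  right_mem : ∀ {a b}, a ≠ b → b ∈ ln a b
  eq : ∀ {a b s t}, a ≠ b → s ≠ t → s ∈ ln a b → t ∈ ln a b → ln s t = ln a b

namespace IsPlane

variable [Fintype X] {ln : X → X → Finset X}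

theorem card_missing (P : IsPlane ln) {a b z : X} (hab : a ≠ b) (hz : z ∉ ln a b) :
    (Finset.univ.filter fun x => ∀ u ∈ ln a b, x ∉ ln z u).card = 3 := by
  have hne : ∀ {u}, u ∈ ln a b → z ≠ u := by
    rintro u hu rfl
    exact hz hu
  have h1 : (Finset.univ.filter fun x => ¬ ∀ u ∈ ln a b, x ∉ ln z u) =
      insert z ((ln a b).biUnion fun u => (ln z u).erase z) := by
    ext x
    simp only [Finset.mem_filter, Finset.mem_univ, true_and, not_forall, not_not,
      Finset.mem_insert, Finset.mem_biUnion, Finset.mem_erase]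
    constructor
    · rintro ⟨u, hu, hx⟩
      by_cases h : x = z
      · exact Or.inl h
      · exact Or.inr ⟨u, hu, h, hx⟩
    · rintro (rfl | ⟨u, hu, -, hx⟩)
      · exact ⟨a, P.left_mem hab, P.left_mem (hne (P.left_mem hab))⟩
      · exact ⟨u, hu, hx⟩
  have h2 : ((ln a b).biUnion fun u => (ln z u).erase z).card = 4 * 3 := by
    rw [Finset.card_biUnion, Finset.sum_const_nat (m := 3), P.card_line hab]
    · intro u hu
      rw [Finset.card_erase_of_mem (P.left_mem (hne hu)), P.card_line (hne hu)]
    · intro u hu v hv huv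
      rw [Function.onFun, Finset.disjoint_left]
      intro x hxu hxv
      rw [Finset.mem_erase] at hxu hxv
      have e1 := P.eq (hne hu) hxu.1.symm (P.left_mem (hne hu)) hxu.2
      have e2 := P.eq (hne hv) hxv.1.symm (P.left_mem (hne hv)) hxv.2
      have e3 : v ∈ ln z u := by
        rw [← e1, e2]
        exact P.right_mem (hne hv)
      have e4 := P.eq (hne hu) huv (P.right_mem (hne hu)) e3
      have e5 := P.eq hab huv hu hv
      apply hz
      rw [← e5, e4]
      exact P.left_mem (hne hu)
  have h3 := Finset.card_filter_add_card_filter_not (s := (Finset.univ : Finset X))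
    fun x => ∀ u ∈ ln a b, x ∉ ln z u
  rw [h1, Finset.card_insert_of_notMem (by simp), h2, Finset.card_univ, P.card_point] at h3
  omega

theorem erase_eq_missing (P : IsPlane ln) {a b z x : X} (hab : a ≠ b) (hz : z ∉ ln a b)
    (hzx : z ≠ x) (h : ∀ u ∈ ln a b, u ∉ ln z x) :
    (ln z x).erase z = Finset.univ.filter fun x => ∀ u ∈ ln a b, x ∉ ln z u := by
  refine Finset.eq_of_subset_of_card_le ?_ ?_
  · intro y hy
    simp only [Finset.mem_filter, Finset.mem_univ, true_and, Finset.mem_erase] at hy ⊢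
    intro u hu hyu
    have hzu : z ≠ u := by
      rintro rfl
      exact hz hu
    have e1 := P.eq hzx hy.1.symm (P.left_mem hzx) hy.2
    have e2 := P.eq hzu hy.1.symm (P.left_mem hzu) hyu
    apply h u hu
    rw [← e1, e2]
    exact P.right_mem hzu
  · rw [P.card_missing hab hz, Finset.card_erase_of_mem (P.left_mem hzx), P.card_line hzx]

theorem exists_parallel (P : IsPlane ln) {a b z : X} (hab : a ≠ b) (hz : z ∉ ln a b) :
    ∃ x, z ≠ x ∧ ∀ u ∈ ln a b, u ∉ ln z x := by
  have : (Finset.univ.filter fun x => ∀ u ∈ ln a b, x ∉ ln z u).Nonempty := by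
    rw [← Finset.card_pos, P.card_missing hab hz]
    simp
  obtain ⟨x, hx⟩ := this
  simp only [Finset.mem_filter, Finset.mem_univ, true_and] at hx
  have hza : z ≠ a := by
    rintro rfl
    exact hz (P.left_mem hab)
  have hzx : z ≠ x := by
    rintro rfl
    exact hx a (P.left_mem hab) (P.left_mem hza)
  refine ⟨x, hzx, fun u hu hux => hx u hu ?_⟩
  have hzu : z ≠ u := by
    rintro rfl
    exact hz hu
  rw [P.eq hzx hzu (P.left_mem hzx) hux]
  exact P.right_mem hzx

/-- A collineation fixing a line pointwise and a point off that line is trivial. -/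
theorem apply_eq (P : IsPlane ln) {f : X → X} (hf : Function.Injective f)
    (hln : ∀ {a b x}, a ≠ b → x ∈ ln a b → f x ∈ ln (f a) (f b)) {p q w z : X} (hp : f p = p)
    (hq : f q = q) (hw : f w = w) (hz : f z = z) (hpq : p ≠ q) (hwp : w ≠ p) (hwq : w ≠ q)
    (hwl : w ∈ ln p q) (hzl : z ∉ ln p q) (x : X) : f x = x := by
  have hL : ∀ u ∈ ln p q, f u = u := by
    intro u hu
    refine apply_eq_of_card_le hf (ln p q) {p, q, w} ?_ ?_ ?_ hu
    · intro y hy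
      simpa [hp, hq] using hln hpq hy
    · intro y hy
      simp only [Finset.mem_insert, Finset.mem_singleton] at hy
      rcases hy with rfl | rfl | rfl
      · exact ⟨P.left_mem hpq, hp⟩
      · exact ⟨P.right_mem hpq, hq⟩
      · exact ⟨hwl, hw⟩
    · rw [P.card_line hpq, Finset.card_eq_three.2 ⟨p, q, w, hpq, hwp.symm, hwq.symm, rfl⟩]
  have hline : ∀ {y}, z ≠ y → f y ∈ ln z y := by
    intro y hzy
    by_cases h : ∃ u ∈ ln p q, u ∈ ln z y
    · obtain ⟨u, hu, huy⟩ := h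
      have hzu : z ≠ u := by
        rintro rfl
        exact hzl hu
      have e := P.eq hzy hzu (P.left_mem hzy) huy
      rw [← e]
      have := hln hzu (x := y) (by rw [e]; exact P.right_mem hzy)
      rwa [hz, hL u hu] at this
    · push Not at h
      have e := P.erase_eq_missing hpq hzl hzy h
      refine Finset.mem_of_mem_erase (a := z) ?_
      have hy : y ∈ (ln z y).erase z := Finset.mem_erase.2 ⟨hzy.symm, P.right_mem hzy⟩
      rw [e] at hy ⊢
      simp only [Finset.mem_filter, Finset.mem_univ, true_and] at hy ⊢
      intro u hu hfy
      have hzu : z ≠ u := by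
        rintro rfl
        exact hzl hu
      obtain ⟨y', hy', e'⟩ := exists_apply_eq hf (S := ln z u) (T := ln z u)
        (fun t ht => by simpa [hz, hL u hu] using hln hzu ht) le_rfl hfy
      rw [hf e'] at hy'
      exact hy u hu hy'
  have key : ∀ {r y}, f r = r → z ≠ r → y ∉ ln z r → f y = y := by
    intro r y hr hzr hy
    by_contra hne
    have hzy : z ≠ y := by
      rintro rfl
      exact hy (P.left_mem hzr)
    have hry : r ≠ y := by
      rintro rfl
      exact hy (P.right_mem hzr)
    have hz' : z ∉ ln r y := by
      intro h
      apply hy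
      rw [P.eq hry hzr h (P.left_mem hry)]
      exact P.right_mem hry
    have hfy : f y ∈ ln r y := by
      obtain ⟨u, hzu, hu⟩ := P.exists_parallel hry hz'
      have hm : ∀ t ∈ ln z u, f t ∈ ln z u := by
        intro t ht
        by_cases h : z = t
        · rw [← h, hz]
          exact P.left_mem hzu
        · rw [← P.eq hzu h (P.left_mem hzu) ht]
          exact hline h
      have hr' : r ∉ ln z u := hu r (P.left_mem hry)
      have hrfy : r ≠ f y := fun h => hry (hf (hr.trans h))
      have e1 := P.erase_eq_missing hzu hr' hry fun t ht ht' => hu t ht' ht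
      have e2 := P.erase_eq_missing hzu hr' hrfy (by
        intro t ht ht'
        obtain ⟨s, hs, rfl⟩ := exists_apply_eq hf (S := ln r y) (T := ln r (f y))
          (fun t ht => by simpa [hr] using hln hry ht)
          (by rw [P.card_line hry, P.card_line hrfy]) ht'
        obtain ⟨s', hs', e⟩ := exists_apply_eq hf (S := ln z u) (T := ln z u) hm le_rfl ht
        rw [hf e] at hs'
        exact hu s hs hs')
      have : f y ∈ (ln r (f y)).erase r := Finset.mem_erase.2 ⟨hrfy.symm, P.right_mem hrfy⟩
      rw [e2, ← e1] at this
      exact Finset.mem_of_mem_erase this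
    apply hz'
    rw [← P.eq hry (Ne.symm hne) (P.right_mem hry) hfy,
      P.eq hzy (Ne.symm hne) (P.right_mem hzy) (hline hzy)]
    exact P.left_mem hzy
  have hzp : z ≠ p := by
    rintro rfl
    exact hzl (P.left_mem hpq)
  have hzq : z ≠ q := by
    rintro rfl
    exact hzl (P.right_mem hpq)
  by_cases hxz : z = x
  · rw [← hxz, hz]
  by_cases hxp : x ∈ ln z p
  · refine key hq hzq fun hxq => hzl ?_
    have e1 := P.eq hzp hxz (P.left_mem hzp) hxp
    have e2 := P.eq hzq hxz (P.left_mem hzq) hxq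
    have hq' : q ∈ ln z p := by
      rw [← e1, e2]
      exact P.right_mem hzq
    rw [P.eq hzp hpq (P.right_mem hzp) hq']
    exact P.left_mem hzp
  · exact key hp hzp hxp

end IsPlane

end

theorem exists_conj_mem {G : Type*} [Group G] {p : ℕ} [Fact p.Prime] {P Y T : Subgroup G}
    (hP : IsPGroup p P) (hPY : P ≤ Y) (hT : ¬ p ∣ T.relIndex Y) :
    ∃ y ∈ Y, ∀ t ∈ P, y⁻¹ * t * y ∈ T := by
  have hP' : IsPGroup p (P.subgroupOf Y) := hP.comap_subtype
  obtain ⟨c, hc⟩ := hP'.nonempty_fixed_point_of_prime_not_dvd_card (Y ⧸ T.subgroupOf Y) hT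
  obtain ⟨y, rfl⟩ := QuotientGroup.mk_surjective c
  refine ⟨y, y.2, fun t ht => ?_⟩
  have h := hc ⟨⟨t, hPY ht⟩, ht⟩
  have h' := QuotientGroup.eq.1 h.symm
  simpa [Subgroup.mem_subgroupOf, mul_assoc] using h'

section

open scoped Classical

variable {G X : Type*} [Group G] [MulAction G X] [Fintype X]

/-- The orbit of a point under a subgroup, as a finite set. -/
noncomputable def orb (K : Subgroup G) (x : X) : Finset X :=
  Finset.univ.filter fun y => ∃ g ∈ K, g • x = y

theorem mem_orb {K : Subgroup G} {x y : X} : y ∈ orb K x ↔ ∃ g ∈ K, g • x = y := by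
  simp [orb]

theorem self_mem_orb (K : Subgroup G) (x : X) : x ∈ orb K x :=
  mem_orb.2 ⟨1, K.one_mem, one_smul _ _⟩

theorem smul_mem_orb {K : Subgroup G} {x y : X} {g : G} (hg : g ∈ K) (hy : y ∈ orb K x) :
    g • y ∈ orb K x := by
  obtain ⟨h, hh, rfl⟩ := mem_orb.1 hy
  exact mem_orb.2 ⟨g * h, K.mul_mem hg hh, mul_smul _ _ _⟩

theorem card_orb (K : Subgroup G) (x : X) : (orb K x).card = (stabilizer G x).relIndex K := by
  have h : (orb K x : Set X) = orbit K x := by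
    ext y
    rw [Finset.mem_coe, mem_orb, mem_orbit_iff]
    exact ⟨fun ⟨g, h1, h2⟩ => ⟨⟨g, h1⟩, h2⟩, fun ⟨g, h⟩ => ⟨g, g.2, h⟩⟩
  rw [← Set.ncard_coe_finset, h, ← index_stabilizer, Subgroup.relIndex]
  rfl

theorem card_inf_stabilizer_mul_card_orb (K : Subgroup G) (x : X) :
    Nat.card (stabilizer G x ⊓ K : Subgroup G) * (orb K x).card = Nat.card K := by
  have h := Subgroup.relIndex_inf_mul_relIndex (⊥ : Subgroup G) (stabilizer G x) K
  rwa [bot_inf_eq, Subgroup.relIndex_bot_left, Subgroup.relIndex_bot_left, ← card_orb] at h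

theorem card_le_card_inf_stabilizer_mul (K : Subgroup G) (x : X) {S : Finset X}
    (hS : ∀ g ∈ K, g • x ∈ S) :
    Nat.card K ≤ Nat.card (stabilizer G x ⊓ K : Subgroup G) * S.card := by
  rw [← card_inf_stabilizer_mul_card_orb K x]
  refine Nat.mul_le_mul_left _ (Finset.card_le_card fun y hy => ?_)
  obtain ⟨g, hg, rfl⟩ := mem_orb.1 hy
  exact hS g hg

theorem pow_dvd_card_orb {p a : ℕ} (hp : p.Prime) {T K : Subgroup G} (hTK : T ≤ K)
    (hT : ¬ p ∣ T.index) {x : X} (h : p ^ a ∣ (orb K x).card) : p ^ a ∣ (orb T x).card := by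
  rw [card_orb] at h ⊢
  have h1 : (stabilizer G x).relIndex K ∣ (stabilizer G x ⊓ T).relIndex K :=
    Subgroup.relIndex_dvd_of_le_left _ inf_le_left
  rw [← Subgroup.relIndex_mul_relIndex _ _ _ inf_le_right hTK,
    Subgroup.inf_relIndex_right] at h1
  refine (Nat.Coprime.pow_left a ?_).dvd_of_dvd_mul_right (h.trans h1)
  rw [hp.coprime_iff_not_dvd]
  exact fun h2 => hT (h2.trans (Subgroup.relIndex_dvd_index_of_le hTK))

/-- Two points fixed by a Sylow subgroup of their stabilizer can be moved to any two other such
points of the same orbit without disturbing the fixed points of that subgroup. -/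
theorem exists_smul_of_fixed {p : ℕ} [Fact p.Prime] {T : Subgroup G} (hT : IsPGroup p T)
    {a b x y : X} (hab : ¬ p ∣ T.relIndex (stabilizer G a ⊓ stabilizer G b))
    (hx : ∀ t ∈ T, t • x = x) (hy : ∀ t ∈ T, t • y = y) {g : G} (hgx : g • a = x)
    (hgy : g • b = y) :
    ∃ n : G, (∀ z : X, (∀ t ∈ T, t • z = z) → ∀ t ∈ T, t • n • z = n • z) ∧ n • a = x ∧
      n • b = y := by
  obtain ⟨u, hu, hu'⟩ := exists_conj_mem (P := T.map (MulAut.conj g⁻¹).toMonoidHom)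
    (Y := stabilizer G a ⊓ stabilizer G b) (T := T) (p := p) (hT.map _) (by
      rintro s ⟨t, ht, rfl⟩
      simp only [MulEquiv.coe_toMonoidHom, MulAut.conj_apply, inv_inv, Subgroup.mem_inf,
        mem_stabilizer_iff, mul_smul, hgx, hgy]
      rw [hx t ht, hy t ht, inv_smul_eq_iff, inv_smul_eq_iff]
      exact ⟨hgx.symm, hgy.symm⟩) hab
  rw [Subgroup.mem_inf, mem_stabilizer_iff, mem_stabilizer_iff] at hu
  refine ⟨g * u, ?_, by rw [mul_smul, hu.1, hgx], by rw [mul_smul, hu.2, hgy]⟩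
  intro z hz t ht
  have e : t • (g * u) • z = (g * u) • (u⁻¹ * (g⁻¹ * t * g) * u) • z := by
    simp only [← mul_smul]
    congr 1
    group
  rw [e, hz _ (hu' (g⁻¹ * t * g) ⟨t, ht, by simp⟩)]

end

section

open scoped Classical Pointwise

variable {G X : Type*} [Group G] [MulAction G X] [Fintype X]

/-- A four-element set `F` of points containing `p` and `q` which is the fixed point set of a
`3`-subgroup and whose setwise stabilizer is doubly transitive on `F`. -/
structure IsQuad (G : Type*) {X : Type*} [Group G] [MulAction G X] (p q : X) (F : Finset X) :
    Prop where
  ne : p ≠ q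
  left_mem : p ∈ F
  right_mem : q ∈ F
  card : F.card = 4
  fixed : ∃ T : Subgroup G, IsPGroup 3 T ∧ ∀ x, x ∈ F ↔ ∀ t ∈ T, t • x = x
  exists_smul : ∀ x ∈ F, ∀ y ∈ F, x ≠ y → ∃ n : G, (∀ z ∈ F, n • z ∈ F) ∧ n • p = x ∧ n • q = y

theorem exists_quad [Finite G] (hX : Fintype.card X = 16)
    (h2 : ∀ a b c d : X, a ≠ b → c ≠ d → ∃ g : G, g • a = c ∧ g • b = d)
    (h7 : ¬ 7 ∣ Nat.card G) {T : Subgroup G} (hT : IsPGroup 3 T) (hTi : ¬ 3 ∣ T.index) {p : X}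
    (hp : ∀ t ∈ T, t • p = p) {S : Finset X} (hS : S.card = 9) (hST : ∀ x ∈ S, orb T x = S)
    (h3 : ∀ x, x ≠ p → 3 ∣ (orb T x).card) :
    ∃ q F, IsQuad G p q F ∧ (orb T q).card = 3 := by
  have : Fact (Nat.Prime 3) := ⟨Nat.prime_three⟩
  have horbp : orb T p = {p} := by
    ext y
    rw [mem_orb, Finset.mem_singleton]
    exact ⟨fun ⟨t, ht, h⟩ => h ▸ hp t ht, fun h => ⟨1, T.one_mem, by rw [h, one_smul]⟩⟩
  have hpS : p ∉ S := by
    intro h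
    have := hST p h
    rw [horbp] at this
    rw [← this] at hS
    simp at hS
  have hR : (insert p S)ᶜ.card = 6 := by
    rw [Finset.card_compl, Finset.card_insert_of_notMem hpS, hS, hX]
  have hTS : ∀ t ∈ T, ∀ x ∈ S, t • x ∈ S := by
    intro t ht x hx
    rw [← hST x hx]
    exact smul_mem_orb ht (self_mem_orb T x)
  have horbR : ∀ x ∈ (insert p S)ᶜ, orb T x ⊆ (insert p S)ᶜ := by
    intro x hx y hy
    obtain ⟨t, ht, rfl⟩ := mem_orb.1 hy
    simp only [Finset.mem_compl, Finset.mem_insert, not_or] at hx ⊢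
    refine ⟨fun h => hx.1 ?_, fun h => hx.2 ?_⟩
    · rw [← hp t ht] at h
      exact smul_left_cancel t h
    · have := hTS _ (T.inv_mem ht) _ h
      rwa [inv_smul_smul] at this
  have hpow : ∀ x : X, ∃ n : ℕ, (orb T x).card = 3 ^ n := by
    intro x
    obtain ⟨n, hn⟩ := IsPGroup.iff_card.1 hT
    have h := card_inf_stabilizer_mul_card_orb T x
    obtain ⟨m, -, hm⟩ := (Nat.dvd_prime_pow Nat.prime_three).1 (hn ▸ Dvd.intro_left _ h)
    exact ⟨m, hm⟩
  have hthree : ∀ x ∈ (insert p S)ᶜ, (orb T x).card = 3 := by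
    intro x hx
    have h := Finset.card_le_card (horbR x hx)
    have hd := h3 x (by rintro rfl; simp at hx)
    rw [hR] at h
    obtain ⟨n, hn⟩ := hpow x
    rw [hn] at h hd ⊢
    rcases n with _ | _ | n
    · simp at hd
    · rfl
    · have : 1 ≤ 3 ^ n := Nat.one_le_pow _ _ (by simp)
      rw [pow_succ, pow_succ] at h
      omega
  obtain ⟨q, hq⟩ : ((insert p S)ᶜ).Nonempty := by
    rw [← Finset.card_pos, hR]
    simp
  have hqp : p ≠ q := by
    rintro rfl
    simp at hq
  set T₁ : Subgroup G := stabilizer G q ⊓ T with hT₁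
  have hT₁T : T₁ ≤ T := inf_le_right
  have hT₁p : IsPGroup 3 T₁ := hT.to_le hT₁T
  set F : Finset X := Finset.univ.filter fun x => ∀ t ∈ T₁, t • x = x with hF
  have hmemF : ∀ x, x ∈ F ↔ ∀ t ∈ T₁, t • x = x := by simp [hF]
  have hpF : p ∈ F := (hmemF p).2 fun t ht => hp t (hT₁T ht)
  have hqF : q ∈ F := (hmemF q).2 fun t ht => ht.1
  have hcardT := card_inf_stabilizer_mul_card_orb T q
  rw [hthree q hq] at hcardT
  have hmod : ∀ U : Finset X, (∀ t ∈ T₁, ∀ x ∈ U, t • x ∈ U) →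
      U.card ≡ (U ∩ F).card [MOD 3] := by
    intro U hU
    have h := card_modEq_card_fixed hT₁p U hU
    convert h using 2
    ext x
    simp [hmemF]
  have hSF : ∀ x ∈ S, x ∉ F := by
    intro x hx hxF
    have h1 : T₁ ≤ stabilizer G x := fun t ht => (hmemF x).1 hxF t ht
    have h2 := Subgroup.relIndex_dvd_of_le_left T h1
    rw [← card_orb, hST x hx, hS, hT₁, Subgroup.inf_relIndex_right, ← card_orb, hthree q hq] at h2
    exact absurd h2 (by decide)
  have hOF : orb T q ⊆ F := by
    have h := hmod ((orb T q).erase q) (by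
      intro t ht x hx
      rw [Finset.mem_erase] at hx ⊢
      refine ⟨fun h => hx.1 ?_, smul_mem_orb (hT₁T ht) hx.2⟩
      rw [← (hmemF q).1 hqF t ht] at h
      exact smul_left_cancel t h)
    have hc : ((orb T q).erase q).card = 2 := by
      rw [Finset.card_erase_of_mem (self_mem_orb T q), hthree q hq]
    have hle := Finset.card_le_card
      (Finset.inter_subset_left (s₁ := (orb T q).erase q) (s₂ := F))
    rw [hc] at h hle
    have he := Finset.eq_of_subset_of_card_le
      (Finset.inter_subset_left (s₁ := (orb T q).erase q) (s₂ := F)) (by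
        unfold Nat.ModEq at h
        omega)
    intro x hx
    by_cases hxq : x = q
    · rwa [hxq]
    · have : x ∈ (orb T q).erase q := Finset.mem_erase.2 ⟨hxq, hx⟩
      rw [← he] at this
      exact (Finset.mem_inter.1 this).2
  have hTY : ¬ 3 ∣ T₁.relIndex (stabilizer G p ⊓ stabilizer G q) := by
    intro h
    have e1 := card_inf_stabilizer_mul_card_orb (⊤ : Subgroup G) p
    have e2 := card_inf_stabilizer_mul_card_orb (stabilizer G p) q
    have o1 : orb (⊤ : Subgroup G) p = Finset.univ := by
      ext y
      simp only [mem_orb, Subgroup.mem_top, true_and, Finset.mem_univ, iff_true]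
      by_cases hy : y = p
      · exact ⟨1, by rw [hy, one_smul]⟩
      · obtain ⟨g, hg, -⟩ := h2 p q y p hqp hy
        exact ⟨g, hg⟩
    have o2 : orb (stabilizer G p) q = Finset.univ.erase p := by
      ext y
      simp only [mem_orb, mem_stabilizer_iff, Finset.mem_erase, Finset.mem_univ, and_true]
      constructor
      · rintro ⟨g, hg, rfl⟩ h
        rw [← hg] at h
        exact hqp (smul_left_cancel g h).symm
      · exact fun hy => h2 p q p y hqp (Ne.symm hy)
    rw [o1, inf_top_eq, Subgroup.card_top, Finset.card_univ, hX] at e1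
    rw [o2, Finset.card_erase_of_mem (Finset.mem_univ _), Finset.card_univ, hX,
      inf_comm] at e2
    have hle : T₁ ≤ stabilizer G p ⊓ stabilizer G q := le_inf (fun t ht => hp t ht.2) inf_le_left
    have e3 := Subgroup.relIndex_inf_mul_relIndex (⊥ : Subgroup G) T₁
      (stabilizer G p ⊓ stabilizer G q)
    rw [bot_inf_eq, Subgroup.relIndex_bot_left, Subgroup.relIndex_bot_left,
      inf_eq_left.2 hle] at e3
    have e4 := T.card_mul_index
    have hpos : 0 < Nat.card T₁ := Nat.card_pos
    obtain ⟨m, hm⟩ := h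
    apply hTi
    refine ⟨80 * m, Nat.eq_of_mul_eq_mul_left (Nat.card_pos (α := T)) ?_⟩
    rw [e4, ← e1, ← e2, ← e3, ← hcardT, hm]
    ring
  have hmove : ∀ x ∈ F, ∀ y ∈ F, x ≠ y →
      ∃ n : G, (∀ z ∈ F, n • z ∈ F) ∧ n • p = x ∧ n • q = y := by
    intro x hx y hy hxy
    obtain ⟨g, hgx, hgy⟩ := h2 p q x y hqp hxy
    obtain ⟨n, hn, h⟩ := exists_smul_of_fixed hT₁p hTY ((hmemF x).1 hx) ((hmemF y).1 hy) hgx hgy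
    exact ⟨n, fun z hz => (hmemF _).2 (hn z ((hmemF z).1 hz)), h⟩
  refine ⟨q, F, ⟨hqp, hpF, hqF, ?_, ⟨T₁, hT₁p, hmemF⟩, hmove⟩, hthree q hq⟩
  have hpO : p ∉ orb T q := fun h => by
    have := horbR q hq h
    simp at this
  have hsub : insert p (orb T q) ⊆ F := Finset.insert_subset hpF hOF
  have hc4 : (insert p (orb T q)).card = 4 := by
    rw [Finset.card_insert_of_notMem hpO, hthree q hq]
  have hup : F.card ≤ 7 := by
    have h1 : F ⊆ insert p (insert p S)ᶜ := by
      intro x hx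
      by_cases hxp : x = p
      · simp [hxp]
      · simpa [hxp] using fun h => hSF x h hx
    have h2 := Finset.card_le_card h1
    rwa [Finset.card_insert_of_notMem (by simp), hR] at h2
  have hlow := Finset.card_le_card hsub
  have h16 := hmod Finset.univ (by simp)
  rw [Finset.univ_inter, Finset.card_univ, hX] at h16
  have hne7 : F.card ≠ 7 := by
    intro h
    apply h7
    have hd := card_dvd_card_subgroup (stabilizer G F) F p ?_
    · rw [h] at hd
      exact hd.trans (Subgroup.card_subgroup_dvd_card _)
    · intro x
      constructor
      · intro hx
        obtain ⟨y, hy, hxy⟩ : ∃ y ∈ F, x ≠ y := by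
          by_cases hxp : x = p
          · exact ⟨q, hqF, hxp ▸ hqp⟩
          · exact ⟨p, hpF, hxp⟩
        obtain ⟨n, hn, h1, -⟩ := hmove x hx y hy hxy
        refine ⟨n, ?_, h1⟩
        rw [mem_stabilizer_finset']
        exact hn
      · rintro ⟨g, hg, rfl⟩
        rw [mem_stabilizer_finset'] at hg
        exact hg hpF
  unfold Nat.ModEq at h16
  omega

end

section

open scoped Classical Pointwise

variable {G X : Type*} [Group G] [MulAction G X]

theorem even_of_regular [Fintype X] (R : X → X → Prop) (hsymm : ∀ {x y}, R x y → R y x)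
    (hirr : ∀ x, ¬ R x x) {S : Finset X} (hS : Odd S.card) (hRS : ∀ {x y}, R x y → x ∈ S) {n : ℕ}
    (hn : ∀ x ∈ S, (Finset.univ.filter fun y => R x y).card = n) : Even n := by
  let Γ : SimpleGraph X := { Adj := R, symm := ⟨fun _ _ => hsymm⟩, loopless := ⟨hirr⟩ }
  have hdeg : ∀ x, Γ.degree x = (Finset.univ.filter fun y => R x y).card := by
    intro x
    rw [← SimpleGraph.card_neighborFinset_eq_degree]
    congr 1
    ext y
    simp [Γ]
  have h := Γ.sum_degrees_eq_twice_card_edges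
  rw [← Finset.sum_subset (Finset.subset_univ S), Finset.sum_congr rfl
    (fun x hx => (hdeg x).trans (hn x hx)), Finset.sum_const, smul_eq_mul] at h
  · exact (Nat.even_mul.1 (h ▸ even_two_mul _)).resolve_left (Nat.not_even_iff_odd.2 hS)
  · intro x _ hx
    rw [hdeg, Finset.card_eq_zero]
    ext y
    simp only [Finset.mem_filter, Finset.mem_univ, true_and, Finset.notMem_empty, iff_false]
    exact fun h => hx (hRS h)

theorem card_filter_smul [Fintype X] {P P' : X → Prop} (g : G) (h : ∀ x, P' (g • x) ↔ P x) :
    (Finset.univ.filter P').card = (Finset.univ.filter P).card := by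
  symm
  refine Finset.card_bij (fun x _ => g • x) (fun x hx => ?_) (fun x _ y _ h => ?_) (fun y hy => ?_)
  · simpa [h] using hx
  · exact smul_left_cancel g h
  · exact ⟨g⁻¹ • y, by simpa [← h] using hy, smul_inv_smul g y⟩

/-- An invariant graph on the fifteen points different from `p` has even valency. -/
theorem even_card_of_invariant [Fintype X] (hX : Fintype.card X = 16)
    (h2 : ∀ a b c d : X, a ≠ b → c ≠ d → ∃ g : G, g • a = c ∧ g • b = d) {p q : X} (hpq : p ≠ q)
    (R : X → X → Prop) (hsymm : ∀ {x y}, R x y → R y x) (hirr : ∀ x, ¬ R x x)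
    (hp : ∀ {x y}, R x y → x ≠ p)
    (hR : ∀ {g : G} {x y}, g • p = p → R x y → R (g • x) (g • y)) :
    Even (Finset.univ.filter fun y => R q y).card := by
  refine even_of_regular R hsymm hirr (S := Finset.univ.erase p) ?_
    (fun h => by simpa using hp h) ?_
  · rw [Finset.card_erase_of_mem (Finset.mem_univ _), Finset.card_univ, hX]
    decide
  · intro x hx
    obtain ⟨g, hgp, rfl⟩ := h2 p q p x hpq (Finset.ne_of_mem_erase hx).symm
    refine card_filter_smul g fun y => ⟨fun h => ?_, fun h => hR hgp h⟩
    simpa using hR (g := g⁻¹) (by rw [inv_smul_eq_iff, hgp]) h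

namespace IsQuad

variable {p q : X} {F : Finset X}

theorem inv_smul_mem {n : G} (hn : ∀ z ∈ F, n • z ∈ F) {z : X} (hz : z ∈ F) : n⁻¹ • z ∈ F := by
  obtain ⟨x, hx, rfl⟩ := exists_apply_eq (MulAction.injective n) hn le_rfl hz
  rwa [inv_smul_smul]

theorem exists_smul_of_ne (Q : IsQuad G p q F) {x y s t : X} (hx : x ∈ F) (hy : y ∈ F) (hs : s ∈ F)
    (ht : t ∈ F) (hxy : x ≠ y) (hst : s ≠ t) :
    ∃ n : G, (∀ z ∈ F, n • z ∈ F) ∧ n • x = s ∧ n • y = t := by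
  obtain ⟨a, ha, rfl, rfl⟩ := Q.exists_smul x hx y hy hxy
  obtain ⟨b, hb, rfl, rfl⟩ := Q.exists_smul s hs t ht hst
  exact ⟨b * a⁻¹, fun z hz => mul_smul b a⁻¹ z ▸ hb _ (inv_smul_mem ha hz),
    by rw [mul_smul, inv_smul_smul], by rw [mul_smul, inv_smul_smul]⟩

theorem eq_or_eq (Q : IsQuad G p q F) {z w x : X} (hz : z ∈ F) (hw : w ∈ F) (hzp : z ≠ p)
    (hzq : z ≠ q) (hwp : w ≠ p) (hwq : w ≠ q) (hzw : z ≠ w) (hx : x ∈ F) :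
    x = p ∨ x = q ∨ x = z ∨ x = w := by
  have h : ({p, q, z, w} : Finset X) = F := by
    refine Finset.eq_of_subset_of_card_le ?_ ?_
    · intro y hy
      simp only [Finset.mem_insert, Finset.mem_singleton] at hy
      rcases hy with rfl | rfl | rfl | rfl
      exacts [Q.left_mem, Q.right_mem, hz, hw]
    · rw [Q.card, Finset.card_insert_of_notMem, Finset.card_insert_of_notMem,
        Finset.card_pair hzw] <;> simp [Q.ne, hzp.symm, hzq.symm, hwp.symm, hwq.symm]
  simpa [← h] using hx

end IsQuad

/-- The relation on the points different from `p` whose pairs are the images of the pairs `q, z`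
with `z` in `F` under the stabilizer of `p`. -/
def QuadAdj (G : Type*) {X : Type*} [Group G] [MulAction G X] (p q : X) (F : Finset X) (x y : X) :
    Prop :=
  ∃ g : G, g • p = p ∧ g • q = x ∧ ∃ z ∈ F, z ≠ p ∧ z ≠ q ∧ g • z = y

namespace IsQuad

variable {p q : X} {F : Finset X}

theorem adj_of_mem {z : X} (hz : z ∈ F) (hzp : z ≠ p) (hzq : z ≠ q) : QuadAdj G p q F q z :=
  ⟨1, one_smul _ _, one_smul _ _, z, hz, hzp, hzq, one_smul _ _⟩

theorem adj_smul {g : G} (hg : g • p = p) {x y : X} (h : QuadAdj G p q F x y) :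
    QuadAdj G p q F (g • x) (g • y) := by
  obtain ⟨a, ha, rfl, z, hz, hzp, hzq, rfl⟩ := h
  exact ⟨g * a, by rw [mul_smul, ha, hg], mul_smul _ _ _, z, hz, hzp, hzq, mul_smul _ _ _⟩

theorem adj_smul_iff {g : G} (hg : g • p = p) {x y : X} :
    QuadAdj G p q F (g • x) (g • y) ↔ QuadAdj G p q F x y :=
  ⟨fun h => by simpa using adj_smul (g := g⁻¹) (by rw [inv_smul_eq_iff, hg]) h, adj_smul hg⟩

theorem adj_ne {x y : X} (h : QuadAdj G p q F x y) : x ≠ y := by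
  obtain ⟨a, -, rfl, z, -, -, hzq, rfl⟩ := h
  exact fun h => hzq (smul_left_cancel a h).symm

theorem adj_symm (Q : IsQuad G p q F) {x y : X} (h : QuadAdj G p q F x y) :
    QuadAdj G p q F y x := by
  obtain ⟨a, ha, rfl, z, hz, hzp, hzq, rfl⟩ := h
  obtain ⟨n, hn, hnp, hnq⟩ := Q.exists_smul p Q.left_mem z hz hzp.symm
  obtain ⟨u, hu, hnu⟩ := exists_apply_eq (MulAction.injective n) hn le_rfl Q.right_mem
  refine adj_smul ha ⟨n, hnp, hnq, u, hu, ?_, ?_, hnu⟩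
  · rintro rfl
    exact Q.ne (hnp.symm.trans hnu)
  · rintro rfl
    exact hzq (hnq.symm.trans hnu)

theorem adj_left_ne (Q : IsQuad G p q F) {x y : X} (h : QuadAdj G p q F x y) : x ≠ p := by
  obtain ⟨a, ha, rfl, -⟩ := h
  intro h
  rw [← ha] at h
  exact Q.ne (smul_left_cancel a (by rw [h, ha])).symm

theorem exists_smul_adj (Q : IsQuad G p q F) {x y s t : X} (h : QuadAdj G p q F x y)
    (h' : QuadAdj G p q F s t) :
    ∃ g : G, g • p = p ∧ (g • x = s ∧ g • y = t ∨ g • x = t ∧ g • y = s) := by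
  obtain ⟨a, ha, rfl, z, hz, hzp, hzq, rfl⟩ := h
  obtain ⟨b, hb, rfl, w, hw, hwp, hwq, rfl⟩ := h'
  obtain ⟨n, hnp, hn⟩ : ∃ n : G, n • p = p ∧ (n • q = q ∧ n • z = w ∨ n • q = w ∧ n • z = q) := by
    by_cases hzw : z = w
    · exact ⟨1, by simp [hzw]⟩
    · obtain ⟨n, hn, hnp, hnw⟩ := Q.exists_smul_of_ne Q.left_mem hw Q.left_mem hz hwp.symm hzp.symm
      refine ⟨n, hnp, ?_⟩
      have key : ∀ {x}, x ∈ F → x ≠ p → x ≠ w → n • x = q ∨ n • x = w := by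
        intro x hx hxp hxw
        rcases Q.eq_or_eq hz hw hzp hzq hwp hwq hzw (hn x hx) with h | h | h | h
        · rw [← hnp] at h
          exact absurd (smul_left_cancel n h) hxp
        · exact Or.inl h
        · rw [← hnw] at h
          exact absurd (smul_left_cancel n h) hxw
        · exact Or.inr h
      have hne : n • q ≠ n • z := fun h => hzq (smul_left_cancel n h).symm
      rcases key Q.right_mem Q.ne.symm hwq.symm with h1 | h1 <;>
        rcases key hz hzp hzw with h2 | h2
      · exact absurd (h1.trans h2.symm) hne
      · exact Or.inl ⟨h1, h2⟩
      · exact Or.inr ⟨h1, h2⟩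
      · exact absurd (h1.trans h2.symm) hne
  refine ⟨b * n * a⁻¹, ?_, ?_⟩
  · have : a⁻¹ • p = p := by rw [inv_smul_eq_iff, ha]
    rw [mul_smul, this, mul_smul, hnp, hb]
  · simp only [mul_smul, inv_smul_smul]
    rcases hn with ⟨h1, h2⟩ | ⟨h1, h2⟩
    · exact Or.inl ⟨by rw [h1], by rw [h2]⟩
    · exact Or.inr ⟨by rw [h1], by rw [h2]⟩

variable [Fintype X]

theorem card_adj [Finite G] (Q : IsQuad G p q F) (hX : Fintype.card X = 16)
    (h2 : ∀ a b c d : X, a ≠ b → c ≠ d → ∃ g : G, g • a = c ∧ g • b = d) :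
    (Finset.univ.filter fun y => QuadAdj G p q F q y).card = 2 ∨
      (Finset.univ.filter fun y => QuadAdj G p q F q y).card = 8 ∨
      (Finset.univ.filter fun y => QuadAdj G p q F q y).card = 14 := by
  have : Fact (Nat.Prime 3) := ⟨Nat.prime_three⟩
  obtain ⟨T, hT, hTF⟩ := Q.fixed
  have he := even_card_of_invariant hX h2 Q.ne (QuadAdj G p q F) Q.adj_symm
    (fun x h => adj_ne h rfl) Q.adj_left_ne (fun hg h => adj_smul hg h)
  set D := Finset.univ.filter fun y => QuadAdj G p q F q y with hD
  have hmod := card_modEq_card_fixed hT D (by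
    intro t ht x hx
    simp only [hD, Finset.mem_filter, Finset.mem_univ, true_and] at hx ⊢
    have := adj_smul ((hTF p).1 Q.left_mem t ht) hx
    rwa [(hTF q).1 Q.right_mem t ht] at this)
  have hfix : (D.filter fun x => ∀ t ∈ T, t • x = x) = (F.erase p).erase q := by
    ext x
    simp only [hD, Finset.mem_filter, Finset.mem_univ, true_and, ← hTF, Finset.mem_erase]
    exact ⟨fun ⟨h, h'⟩ => ⟨(adj_ne h).symm, Q.adj_left_ne (Q.adj_symm h), h'⟩,
      fun ⟨h1, h2, h3⟩ => ⟨adj_of_mem h3 h2 h1, h3⟩⟩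
  have hle : D ⊆ (Finset.univ.erase p).erase q := by
    intro x hx
    simp only [hD, Finset.mem_filter, Finset.mem_univ, true_and] at hx
    simp [(adj_ne hx).symm, Q.adj_left_ne (Q.adj_symm hx)]
  have hle' := Finset.card_le_card hle
  rw [hfix, Finset.card_erase_of_mem (by simp [Q.right_mem, Q.ne.symm]),
    Finset.card_erase_of_mem Q.left_mem, Q.card] at hmod
  rw [Finset.card_erase_of_mem (by simp [Q.ne.symm]),
    Finset.card_erase_of_mem (by simp), Finset.card_univ, hX] at hle'
  unfold Nat.ModEq at hmod
  rw [Nat.even_iff] at he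
  omega

theorem seven_dvd_card [Finite G] (Q : IsQuad G p q F) (hX : Fintype.card X = 16)
    (h2 : ∀ a b c d : X, a ≠ b → c ≠ d → ∃ g : G, g • a = c ∧ g • b = d)
    (hD : (Finset.univ.filter fun y => QuadAdj G p q F q y).card = 14) : 7 ∣ Nat.card G := by
  have hall : ∀ y, y ≠ p → y ≠ q → QuadAdj G p q F q y := by
    have h : (Finset.univ.filter fun y => QuadAdj G p q F q y) = (Finset.univ.erase p).erase q := by
      refine Finset.eq_of_subset_of_card_le ?_ ?_
      · intro x hx
        simp only [Finset.mem_filter, Finset.mem_univ, true_and] at hx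
        simp [(adj_ne hx).symm, Q.adj_left_ne (Q.adj_symm hx)]
      · rw [hD, Finset.card_erase_of_mem (by simp [Q.ne.symm]),
          Finset.card_erase_of_mem (by simp), Finset.card_univ, hX]
    intro y hyp hyq
    have : y ∈ (Finset.univ.erase p).erase q := by simp [hyp, hyq]
    rw [← h] at this
    simpa using this
  obtain ⟨w, hw⟩ : ((F.erase p).erase q).Nonempty := by
    rw [← Finset.card_pos, Finset.card_erase_of_mem (by simp [Q.right_mem, Q.ne.symm]),
      Finset.card_erase_of_mem Q.left_mem, Q.card]
    simp
  simp only [Finset.mem_erase] at hw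
  have hd := card_dvd_card_subgroup (⊤ : Subgroup G) (Finset.powersetCard 3 Finset.univ)
    ({p, q, w} : Finset X) (by
      intro U
      simp only [Finset.mem_powersetCard, Finset.subset_univ, true_and, Subgroup.mem_top]
      constructor
      · intro hU
        obtain ⟨a, b, e, hab, hae, hbe, rfl⟩ := Finset.card_eq_three.1 hU
        obtain ⟨g, rfl, rfl⟩ := h2 p q a b Q.ne hab
        obtain ⟨s, hs⟩ : ∃ s, e = g • s := ⟨g⁻¹ • e, (smul_inv_smul g e).symm⟩
        subst hs
        have hadj := hall s (fun h => hae (by rw [h])) (fun h => hbe (by rw [h]))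
        obtain ⟨m, hmp, hm⟩ := Q.exists_smul_adj (adj_of_mem (G := G) hw.2.2 hw.2.1 hw.1) hadj
        refine ⟨g * m, ?_⟩
        simp only [Finset.smul_finset_insert, Finset.smul_finset_singleton, mul_smul, hmp]
        rcases hm with ⟨h1, h2⟩ | ⟨h1, h2⟩
        · rw [h1, h2]
        · rw [h1, h2, Finset.pair_comm]
      · rintro ⟨g, rfl⟩
        rw [Finset.card_smul_finset, Finset.card_eq_three]
        exact ⟨p, q, w, Q.ne, Ne.symm hw.2.1, Ne.symm hw.1, rfl⟩)
  rw [Finset.card_powersetCard, Finset.card_univ, hX, Subgroup.card_top] at hd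
  exact (by decide : 7 ∣ Nat.choose 16 3).trans hd

end IsQuad

end

section

open scoped Classical

variable {G X : Type*} [Group G] [MulAction G X] [Fintype X]

theorem card_stabilizer_le (p : X) {q a b : X} {S₁ S₂ S₃ : Finset X}
    (h₁ : ∀ g : G, g • p = p → g • q ∈ S₁)
    (h₂ : ∀ g : G, g • p = p → g • q = q → g • a ∈ S₂)
    (h₃ : ∀ g : G, g • p = p → g • q = q → g • a = a → g • b ∈ S₃) :
    Nat.card (stabilizer G p) ≤ Nat.card
      (stabilizer G b ⊓ (stabilizer G a ⊓ (stabilizer G q ⊓ stabilizer G p)) : Subgroup G) *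
        S₃.card * S₂.card * S₁.card := by
  have e1 := card_le_card_inf_stabilizer_mul (stabilizer G p) q (S := S₁) fun g hg => h₁ g hg
  have e2 := card_le_card_inf_stabilizer_mul (stabilizer G q ⊓ stabilizer G p) a (S := S₂)
    fun g hg => h₂ g hg.2 hg.1
  have e3 := card_le_card_inf_stabilizer_mul (stabilizer G a ⊓ (stabilizer G q ⊓ stabilizer G p)) b
    (S := S₃) fun g hg => h₃ g hg.2.2 hg.2.1 hg.1
  exact e1.trans (Nat.mul_le_mul_right _ (e2.trans (Nat.mul_le_mul_right _ e3)))

theorem smul_mem_univ_erase {p q : X} (hpq : p ≠ q) {g : G} (hg : g • p = p) :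
    g • q ∈ Finset.univ.erase p := by
  simp only [Finset.mem_erase, Finset.mem_univ, and_true]
  intro h
  rw [← hg] at h
  exact hpq (smul_left_cancel g h).symm

namespace IsQuad

variable {p q : X} {F : Finset X}

/-- If the relation has valency two then the images of `F` are the lines of an affine plane. -/
theorem card_stabilizer_le_of_card_eq_two (Q : IsQuad G p q F) (hX : Fintype.card X = 16)
    (h2 : ∀ a b c d : X, a ≠ b → c ≠ d → ∃ g : G, g • a = c ∧ g • b = d)
    (hK : ∀ g : G, (∀ x : X, g • x = x) → g = 1)
    (hD : (Finset.univ.filter fun y => QuadAdj G p q F q y).card = 2) :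
    Nat.card (stabilizer G p) ≤ 360 := by
  have hE2 : ((F.erase p).erase q).card = 2 := by
    rw [Finset.card_erase_of_mem (by simp [Q.right_mem, Q.ne.symm]),
      Finset.card_erase_of_mem Q.left_mem, Q.card]
  have hDF : (F.erase p).erase q = Finset.univ.filter fun y => QuadAdj G p q F q y := by
    refine Finset.eq_of_subset_of_card_le ?_ (by rw [hD, hE2])
    intro x hx
    simp only [Finset.mem_erase] at hx
    simpa using adj_of_mem hx.2.2 hx.2.1 hx.1
  have hF : ∀ g : G, g • p = p → g • q = q → ∀ x ∈ F, g • x ∈ F := by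
    intro g hgp hgq x hx
    by_cases hxp : x = p
    · rw [hxp, hgp]
      exact Q.left_mem
    by_cases hxq : x = q
    · rw [hxq, hgq]
      exact Q.right_mem
    have h := adj_smul hgp (adj_of_mem (G := G) hx hxp hxq)
    rw [hgq] at h
    have : g • x ∈ (F.erase p).erase q := by
      rw [hDF]
      simpa using h
    exact Finset.mem_of_mem_erase (Finset.mem_of_mem_erase this)
  let ln : X → X → Finset X := fun a b =>
    Finset.univ.filter fun x => ∃ g : G, g • p = a ∧ g • q = b ∧ ∃ z ∈ F, g • z = x
  have hln : ∀ (g : G) (x : X), x ∈ ln (g • p) (g • q) ↔ ∃ z ∈ F, g • z = x := by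
    intro g x
    simp only [ln, Finset.mem_filter, Finset.mem_univ, true_and]
    refine ⟨?_, fun h => ⟨g, rfl, rfl, h⟩⟩
    rintro ⟨m, hmp, hmq, z, hz, rfl⟩
    refine ⟨(g⁻¹ * m) • z, hF _ ?_ ?_ z hz, ?_⟩
    · rw [mul_smul, hmp, inv_smul_smul]
    · rw [mul_smul, hmq, inv_smul_smul]
    · rw [mul_smul, smul_inv_smul]
  have P : IsPlane ln := by
    refine ⟨hX, ?_, ?_, ?_, ?_⟩
    · intro a b hab
      obtain ⟨g, rfl, rfl⟩ := h2 p q a b Q.ne hab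
      rw [← Q.card, ← Finset.card_image_of_injective F (MulAction.injective g)]
      congr 1
      ext x
      rw [hln, Finset.mem_image]
    · intro a b hab
      obtain ⟨g, rfl, rfl⟩ := h2 p q a b Q.ne hab
      exact (hln _ _).2 ⟨p, Q.left_mem, rfl⟩
    · intro a b hab
      obtain ⟨g, rfl, rfl⟩ := h2 p q a b Q.ne hab
      exact (hln _ _).2 ⟨q, Q.right_mem, rfl⟩
    · intro a b s t hab hst hs ht
      obtain ⟨g, rfl, rfl⟩ := h2 p q a b Q.ne hab
      obtain ⟨s', hs', rfl⟩ := (hln _ _).1 hs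
      obtain ⟨t', ht', rfl⟩ := (hln _ _).1 ht
      obtain ⟨n, hn, rfl, rfl⟩ := Q.exists_smul s' hs' t' ht' fun h => hst (by rw [h])
      ext x
      rw [hln, ← mul_smul, ← mul_smul, hln]
      constructor
      · rintro ⟨z, hz, rfl⟩
        exact ⟨n • z, hn z hz, (mul_smul _ _ _).symm⟩
      · rintro ⟨z, hz, rfl⟩
        exact ⟨n⁻¹ • z, inv_smul_mem hn hz, by rw [mul_smul, smul_inv_smul]⟩
  have hlnF : ∀ x, x ∈ ln p q ↔ x ∈ F := by
    intro x
    have := hln 1 x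
    simpa using this
  obtain ⟨w, hw⟩ : ((F.erase p).erase q).Nonempty := by
    rw [← Finset.card_pos, hE2]
    simp
  have hFc : (Fᶜ).card = 12 := by rw [Finset.card_compl, Q.card, hX]
  obtain ⟨z, hz⟩ : (Fᶜ).Nonempty := by
    rw [← Finset.card_pos, hFc]
    simp
  have hw' := hw
  simp only [Finset.mem_erase] at hw'
  have hb := card_stabilizer_le (G := G) p (q := q) (a := w) (b := z) (S₁ := Finset.univ.erase p)
    (S₂ := (F.erase p).erase q) (S₃ := Fᶜ) (fun g hg => smul_mem_univ_erase Q.ne hg) (by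
      intro g hp hq
      rw [hDF]
      have := adj_smul hp (adj_of_mem (G := G) hw'.2.2 hw'.2.1 hw'.1)
      rw [hq] at this
      simpa using this) (by
      intro g hp hq _
      rw [Finset.mem_compl] at hz ⊢
      exact fun h => hz (by simpa using inv_smul_mem (hF g hp hq) h))
  have htriv : (stabilizer G z ⊓ (stabilizer G w ⊓ (stabilizer G q ⊓ stabilizer G p)) :
      Subgroup G) = ⊥ := by
    rw [eq_bot_iff]
    rintro g ⟨hgz, hgw, hgq, hgp⟩
    refine hK g (P.apply_eq (MulAction.injective g) ?_ hgp hgq hgw hgz Q.ne hw'.2.1 hw'.1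
      ((hlnF w).2 hw'.2.2) fun h => (Finset.mem_compl.1 hz) ((hlnF z).1 h))
    intro a b x hab hx
    obtain ⟨m, rfl, rfl⟩ := h2 p q a b Q.ne hab
    obtain ⟨y, hy, rfl⟩ := (hln _ _).1 hx
    rw [← mul_smul, ← mul_smul, ← mul_smul, hln]
    exact ⟨y, hy, rfl⟩
  rw [htriv, Subgroup.card_bot, hFc, hE2, Finset.card_erase_of_mem (Finset.mem_univ _),
    Finset.card_univ, hX] at hb
  omega

end IsQuad

end

section

open scoped Classical

variable {G X : Type*} [Group G] [MulAction G X] [Fintype X]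

/-- Being distinct, different from `p` and not related by `QuadAdj`. -/
def QuadNonadj (G : Type*) {X : Type*} [Group G] [MulAction G X] (p q : X) (F : Finset X)
    (x y : X) : Prop :=
  x ≠ p ∧ y ≠ p ∧ x ≠ y ∧ ¬ QuadAdj G p q F x y

namespace IsQuad

variable {p q : X} {F : Finset X}

theorem nonadj_symm (Q : IsQuad G p q F) {x y : X} (h : QuadNonadj G p q F x y) :
    QuadNonadj G p q F y x :=
  ⟨h.2.1, h.1, h.2.2.1.symm, fun h' => h.2.2.2 (Q.adj_symm h')⟩

theorem nonadj_smul_iff {g : G} (hg : g • p = p) {x y : X} :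
    QuadNonadj G p q F (g • x) (g • y) ↔ QuadNonadj G p q F x y := by
  have h : ∀ z : X, g • z = p ↔ z = p := fun z => by
    rw [smul_eq_iff_eq_inv_smul, inv_smul_eq_iff.2 hg.symm]
  simp only [QuadNonadj, adj_smul_iff hg, ne_eq, h, (MulAction.injective g).eq_iff]

/-- If the relation has valency eight then its complement is the collinearity graph of a
generalized quadrangle. -/
theorem card_stabilizer_le_of_card_eq_eight [Finite G] (Q : IsQuad G p q F)
    (hX : Fintype.card X = 16)
    (h2 : ∀ a b c d : X, a ≠ b → c ≠ d → ∃ g : G, g • a = c ∧ g • b = d)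
    (hK : ∀ g : G, (∀ x : X, g • x = x) → g = 1)
    (hD : (Finset.univ.filter fun y => QuadAdj G p q F q y).card = 8) :
    Nat.card (stabilizer G p) ≤ 720 := by
  have : Fact (Nat.Prime 3) := ⟨Nat.prime_three⟩
  obtain ⟨T, hT, hTF⟩ := Q.fixed
  set E : X → X → Prop := QuadAdj G p q F with hE
  set R : X → X → Prop := QuadNonadj G p q F with hR
  let N : X → Finset X := fun x => Finset.univ.filter fun y => R x y
  have hN : ∀ x y, y ∈ N x ↔ R x y := by simp [N]
  have hcardD : ∀ x, x ≠ p → (Finset.univ.filter fun y => E x y).card = 8 := by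
    intro x hx
    obtain ⟨g, hgp, rfl⟩ := h2 p q p x Q.ne hx.symm
    rw [← hD]
    exact card_filter_smul g fun y => adj_smul_iff hgp
  have hV : (Finset.univ.erase p : Finset X).card = 15 := by
    rw [Finset.card_erase_of_mem (Finset.mem_univ _), Finset.card_univ, hX]
  have hdeg : ∀ x, x ≠ p → (N x).card = 6 := by
    intro x hx
    have hsplit : Finset.univ.erase p =
        insert x (N x ∪ Finset.univ.filter fun y => E x y) := by
      ext y
      simp only [Finset.mem_erase, Finset.mem_univ, and_true, Finset.mem_insert, Finset.mem_union,
        hN, Finset.mem_filter, true_and]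
      constructor
      · intro hy
        by_cases hxy : y = x
        · exact Or.inl hxy
        · by_cases h : E x y
          · exact Or.inr (Or.inr h)
          · exact Or.inr (Or.inl ⟨hx, hy, Ne.symm hxy, h⟩)
      · rintro (rfl | h | h)
        · exact hx
        · exact h.2.1
        · exact Q.adj_left_ne (Q.adj_symm h)
    rw [hsplit, Finset.card_insert_of_notMem, Finset.card_union_of_disjoint, hcardD x hx] at hV
    · omega
    · rw [Finset.disjoint_left]
      intro y hy hy'
      exact ((hN x y).1 hy).2.2.2 (by simpa using hy')
    · simp only [Finset.mem_union, hN, Finset.mem_filter, Finset.mem_univ, true_and, not_or]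
      exact ⟨fun h => h.2.2.1 rfl, fun h => adj_ne h rfl⟩
  have hqp : q ≠ p := Q.ne.symm
  have hpair : ∀ {z x y}, R q z → R x y →
      ∃ g : G, g • p = p ∧ (g • q = x ∧ g • z = y ∨ g • q = y ∧ g • z = x) := by
    intro z x y hz hxy
    let S : X → X → Prop := fun x y =>
      ∃ g : G, g • p = p ∧ (g • q = x ∧ g • z = y ∨ g • q = y ∧ g • z = x)
    have hSR : ∀ {x y}, S x y → R x y := by
      rintro x y ⟨g, hg, ⟨rfl, rfl⟩ | ⟨rfl, rfl⟩⟩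
      · exact (nonadj_smul_iff hg).2 hz
      · exact Q.nonadj_symm ((nonadj_smul_iff hg).2 hz)
    have hS : ∀ {g : G} {x y}, g • p = p → S x y → S (g • x) (g • y) := by
      rintro g x y hg ⟨m, hm, h⟩
      refine ⟨g * m, by rw [mul_smul, hm, hg], ?_⟩
      rcases h with ⟨rfl, rfl⟩ | ⟨rfl, rfl⟩
      · exact Or.inl ⟨mul_smul _ _ _, mul_smul _ _ _⟩
      · exact Or.inr ⟨mul_smul _ _ _, mul_smul _ _ _⟩
    have heven := even_card_of_invariant hX h2 Q.ne S (fun ⟨g, hg, h⟩ => ⟨g, hg, h.symm⟩)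
      (fun x h => (hSR h).2.2.1 rfl) (fun h => (hSR h).1) (fun hg h => hS hg h)
    set U := Finset.univ.filter fun y => S q y with hU
    have hmod := card_modEq_card_fixed hT U (by
      intro t ht x hx
      simp only [hU, Finset.mem_filter, Finset.mem_univ, true_and] at hx ⊢
      have := hS ((hTF p).1 Q.left_mem t ht) hx
      rwa [(hTF q).1 Q.right_mem t ht] at this)
    have hfix : (U.filter fun x => ∀ t ∈ T, t • x = x) = ∅ := by
      ext x
      simp only [hU, Finset.mem_filter, Finset.mem_univ, true_and, ← hTF, Finset.notMem_empty,
        iff_false, not_and]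
      exact fun h hx => (hSR h).2.2.2 (adj_of_mem hx (hSR h).2.1 (hSR h).2.2.1.symm)
    have hUN : U ⊆ N q := by
      intro x hx
      rw [hN]
      exact hSR (by simpa [hU] using hx)
    have hpos : 0 < U.card := by
      rw [Finset.card_pos]
      exact ⟨z, by simpa [hU] using ⟨1, by simp⟩⟩
    have hle := Finset.card_le_card hUN
    rw [hfix, Finset.card_empty] at hmod
    rw [hdeg q hqp] at hle
    have hUeq : U = N q := by
      refine Finset.eq_of_subset_of_card_le hUN ?_
      rw [hdeg q hqp]
      unfold Nat.ModEq at hmod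
      rw [Nat.even_iff] at heven
      omega
    obtain ⟨g, hgp, rfl⟩ := h2 p q p x Q.ne hxy.1.symm
    obtain ⟨y, rfl⟩ : ∃ y', y = g • y' := ⟨g⁻¹ • y, (smul_inv_smul g y).symm⟩
    rw [hR, nonadj_smul_iff hgp, ← hR, ← hN, ← hUeq] at hxy
    exact hS hgp (by simpa [hU] using hxy)
  have hinter : ∀ (g : G) (x y : X), g • p = p →
      (N (g • x) ∩ N (g • y)).card = (N x ∩ N y).card := by
    intro g x y hg
    simp only [N, ← Finset.filter_and]
    convert card_filter_smul (P := fun t => R x t ∧ R y t)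
      (P' := fun t => R (g • x) t ∧ R (g • y) t) g fun t => by
        rw [hR, nonadj_smul_iff hg, nonadj_smul_iff hg]
  obtain ⟨z, hz⟩ : (N q).Nonempty := by
    rw [← Finset.card_pos, hdeg q hqp]
    simp
  obtain ⟨w, hw⟩ : (Finset.univ.filter fun y => E q y).Nonempty := by
    rw [← Finset.card_pos, hcardD q hqp]
    simp
  have hw' : E q w := by simpa using hw
  have hl : ∀ {x y}, R x y → (N x ∩ N y).card = (N q ∩ N z).card := by
    intro x y hxy
    obtain ⟨g, hg, ⟨rfl, rfl⟩ | ⟨rfl, rfl⟩⟩ := hpair ((hN q z).1 hz) hxy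
    · exact hinter g _ _ hg
    · rw [Finset.inter_comm]
      exact hinter g _ _ hg
  have hm : ∀ {x y}, E x y → (N x ∩ N y).card = (N q ∩ N w).card := by
    intro x y hxy
    obtain ⟨g, hg, ⟨rfl, rfl⟩ | ⟨rfl, rfl⟩⟩ := Q.exists_smul_adj hw' hxy
    · exact hinter g _ _ hg
    · rw [Finset.inter_comm]
      exact hinter g _ _ hg
  have hND : ∀ a ∈ N q,
      (N a ∩ Finset.univ.filter fun y => E q y).card + (N q ∩ N z).card + 1 = 6 := by
    intro a ha
    have ha' := (hN q a).1 ha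
    rw [← hl ha', ← hdeg a ha'.2.1]
    have hsplit : N a = insert q ((N a ∩ Finset.univ.filter fun y => E q y) ∪ (N q ∩ N a)) := by
      ext y
      simp only [Finset.mem_insert, Finset.mem_union, Finset.mem_inter, hN, Finset.mem_filter,
        Finset.mem_univ, true_and]
      constructor
      · intro hy
        by_cases hyq : y = q
        · exact Or.inl hyq
        · by_cases h : E q y
          · exact Or.inr (Or.inl ⟨hy, h⟩)
          · exact Or.inr (Or.inr ⟨⟨hqp, hy.2.1, Ne.symm hyq, h⟩, hy⟩)
      · rintro (rfl | h | h)
        · exact Q.nonadj_symm ha'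
        · exact h.1
        · exact h.2
    conv_rhs => rw [hsplit]
    rw [Finset.card_insert_of_notMem, Finset.card_union_of_disjoint]
    · rw [Finset.disjoint_left]
      intro y hy hy'
      simp only [Finset.mem_inter, hN, Finset.mem_filter, Finset.mem_univ, true_and] at hy hy'
      exact hy'.1.2.2.2 hy.2
    · simp only [Finset.mem_union, Finset.mem_inter, hN, Finset.mem_filter, Finset.mem_univ,
        true_and, not_or]
      exact ⟨fun h => adj_ne h.2 rfl, fun h => h.1.2.2.1 rfl⟩
  have hcount : 6 * (5 - (N q ∩ N z).card) = 8 * (N q ∩ N w).card := by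
    have h := Finset.sum_card_bipartiteAbove_eq_sum_card_bipartiteBelow (s := N q)
      (t := Finset.univ.filter fun y => E q y) (fun a y => R a y)
    have e1 : ∀ a ∈ N q, (Finset.bipartiteAbove (fun a y => R a y)
        (Finset.univ.filter fun y => E q y) a).card = 5 - (N q ∩ N z).card := by
      intro a ha
      have h1 := hND a ha
      have h2 : Finset.bipartiteAbove (fun a y => R a y) (Finset.univ.filter fun y => E q y) a =
          N a ∩ Finset.univ.filter fun y => E q y := by
        ext y
        simp [hN, Finset.mem_bipartiteAbove, and_comm]
      rw [h2]
      omega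
    have e2 : ∀ y ∈ Finset.univ.filter fun y => E q y, (Finset.bipartiteBelow (fun a y => R a y)
        (N q) y).card = (N q ∩ N w).card := by
      intro y hy
      rw [← hm (by simpa using hy : E q y)]
      congr 1
      ext a
      simp only [Finset.mem_bipartiteBelow, Finset.mem_inter, hN]
      exact and_congr_right fun _ => ⟨fun h => Q.nonadj_symm h, fun h => Q.nonadj_symm h⟩
    rw [Finset.sum_congr rfl e1, Finset.sum_congr rfl e2, Finset.sum_const, Finset.sum_const,
      hdeg q hqp, hcardD q hqp, smul_eq_mul, smul_eq_mul] at h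
    exact h
  have hmu : (N q ∩ N w).card ≠ 0 := by
    intro h0
    have hdisj : ∀ {x y}, E x y → Disjoint (N x) (N y) := fun h => by
      rw [Finset.disjoint_iff_inter_eq_empty, ← Finset.card_eq_zero, hm h, h0]
    have hsub : ∀ {y}, E q y → N y ⊆ (Finset.univ.filter fun y => E q y) := by
      intro y hy x hx
      have hx' := (hN _ _).1 hx
      simp only [Finset.mem_filter, Finset.mem_univ, true_and]
      by_contra h
      refine Finset.disjoint_left.1 (hdisj hy) ((hN _ _).2 ⟨hqp, hx'.2.1, ?_, h⟩) hx
      rintro rfl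
      exact hx'.2.2.2 (Q.adj_symm hy)
    have hwp := Q.adj_left_ne (Q.adj_symm hw')
    obtain ⟨u, hu, huN⟩ : ∃ u ∈ (Finset.univ.filter fun y => E q y).erase w, u ∉ N w := by
      by_contra! h
      have := Finset.card_le_card (show (Finset.univ.filter fun y => E q y).erase w ⊆ N w from h)
      rw [Finset.card_erase_of_mem hw, hcardD q hqp, hdeg w hwp] at this
      omega
    simp only [Finset.mem_erase, Finset.mem_filter, Finset.mem_univ, true_and] at hu
    have hup := Q.adj_left_ne (Q.adj_symm hu.2)
    have hEwu : E w u := by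
      by_contra h
      exact huN ((hN _ _).2 ⟨hwp, hup, Ne.symm hu.1, h⟩)
    have hle := Finset.card_le_card (Finset.union_subset (hsub hw') (hsub hu.2))
    rw [Finset.card_union_of_disjoint (hdisj hEwu), hdeg w hwp, hdeg u hup, hcardD q hqp] at hle
    omega
  have hval : (N q ∩ N z).card = 1 ∧ (N q ∩ N w).card = 3 := by
    have := hND z hz
    omega
  have QD : IsQuadrangle (Finset.univ.erase p) N := by
    refine ⟨?_, ?_, ?_, ?_, ?_, ?_⟩
    · intro x y h
      simpa using ((hN _ _).1 h).2.1
    · intro x y h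
      exact (hN _ _).2 (Q.nonadj_symm ((hN _ _).1 h))
    · intro x h
      exact ((hN _ _).1 h).2.2.1 rfl
    · intro x hx
      exact hdeg x (Finset.ne_of_mem_erase hx)
    · intro x y h
      rw [hl ((hN _ _).1 h), hval.1]
    · intro x y hx hy hxy h
      rw [← hval.2]
      refine hm ?_
      by_contra hE
      exact h ((hN _ _).2 ⟨Finset.ne_of_mem_erase hx, Finset.ne_of_mem_erase hy, hxy, hE⟩)
  obtain ⟨a, b, ha, hb, hab⟩ : ∃ a b, a ∈ N q ∩ N w ∧ b ∈ N q ∩ N w ∧ a ≠ b := by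
    have := Finset.one_lt_card.1 (show 1 < (N q ∩ N w).card by omega)
    obtain ⟨a, ha, b, hb, hab⟩ := this
    exact ⟨a, b, ha, hb, hab⟩
  have hsm : ∀ {g : G} {x y : X}, g • p = p → y ∈ N x → g • y ∈ N (g • x) := by
    intro g x y hg h
    exact (hN _ _).2 ((nonadj_smul_iff hg).2 ((hN _ _).1 h))
  have hb1 := card_stabilizer_le (G := G) p (q := q) (a := w) (b := a)
    (S₁ := Finset.univ.erase p) (S₂ := Finset.univ.filter fun y => E q y) (S₃ := N q ∩ N w)
    (fun g hg => smul_mem_univ_erase Q.ne hg) (by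
      intro g hp hq
      have := adj_smul hp hw'
      rw [hq] at this
      simpa using this) (by
      intro g hp hq hw
      rw [Finset.mem_inter] at ha ⊢
      exact ⟨by simpa [hq] using hsm hp ha.1, by simpa [hw] using hsm hp ha.2⟩)
  have hb2 := card_le_card_inf_stabilizer_mul
    (stabilizer G a ⊓ (stabilizer G w ⊓ (stabilizer G q ⊓ stabilizer G p))) b
    (S := (N q ∩ N w).erase a) (by
      rintro g ⟨hga, hgw, hgq, hgp⟩
      change g • _ = _ at hga hgw hgq hgp
      rw [Finset.mem_erase, Finset.mem_inter]
      rw [Finset.mem_inter] at hb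
      refine ⟨fun h => hab ?_, by simpa [hgq] using hsm hgp hb.1, by
        simpa [hgw] using hsm hgp hb.2⟩
      rw [← hga] at h
      exact (smul_left_cancel g h).symm)
  have htriv : (stabilizer G b ⊓ (stabilizer G a ⊓ (stabilizer G w ⊓
      (stabilizer G q ⊓ stabilizer G p))) : Subgroup G) = ⊥ := by
    rw [eq_bot_iff]
    rintro g ⟨hgb, hga, hgw, hgq, hgp⟩
    refine hK g fun x => ?_
    by_cases hxp : x = p
    · rw [hxp]
      exact hgp
    rw [Finset.mem_inter] at ha hb
    exact QD.apply_eq (MulAction.injective g)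
      (fun y hy => smul_mem_univ_erase (Finset.ne_of_mem_erase hy).symm hgp)
      (fun h => hsm hgp h) hgq hgw hga hgb (adj_ne hw')
      (fun h => ((hN _ _).1 h).2.2.2 hw') ha.1 ha.2 hb.1 hb.2 hab (by simpa using hxp)
  rw [htriv, Subgroup.card_bot, Finset.card_erase_of_mem ha, hval.2] at hb2
  rw [hval.2, hcardD q hqp, hV] at hb1
  omega

end IsQuad

end

theorem conj_mem_of_card_eq_forty_five {G : Type*} [Group G] [Finite G] {A T : Subgroup G}
    (hA : Nat.card A = 45) (hTA : T ≤ A) (hT : IsPGroup 3 T) (hTi : ¬ 3 ∣ T.index) {g t : G}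
    (hg : g ∈ A) (ht : t ∈ T) : g⁻¹ * t * g ∈ T := by
  have : Fact (Nat.Prime 3) := ⟨Nat.prime_three⟩
  have hi : ¬ 3 ∣ (T.subgroupOf A).index := fun h =>
    hTi (h.trans (Subgroup.relIndex_dvd_index_of_le hTA))
  let P : Sylow 3 A := IsPGroup.toSylow (hT.comap_subtype) hi
  have hP : (P : Subgroup A) = T.subgroupOf A := rfl
  have hidx : (P : Subgroup A).index = 5 := by
    rw [hP]
    obtain ⟨n, hn⟩ := IsPGroup.iff_card.1 (hT.comap_subtype (K := A))
    have h := (T.subgroupOf A).card_mul_index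
    rw [hA] at h
    change Nat.card (T.subgroupOf A) = 3 ^ n at hn
    rw [hn] at h
    rcases n with _ | _ | _ | n
    · omega
    · omega
    · omega
    · rw [pow_succ, pow_succ, pow_succ] at h
      exact absurd (Dvd.intro _ (by rw [← h]; ring : 27 * (3 ^ n * (T.subgroupOf A).index) = 45))
        (by decide)
  have hd := P.card_dvd_index
  have hm := card_sylow_modEq_one 3 A
  rw [hidx, Nat.dvd_prime (by norm_num)] at hd
  have h1 : Nat.card (Sylow 3 A) = 1 := by
    rcases hd with h | h
    · exact h
    · rw [h] at hm
      exact absurd hm (by decide)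
  have : Subsingleton (Sylow 3 A) := (Nat.card_eq_one_iff_unique.1 h1).1
  have hn : (P : Subgroup A).Normal := inferInstance
  have := hn.conj_mem ⟨t, hTA ht⟩ (by rw [hP, Subgroup.mem_subgroupOf]; exact ht)
    ⟨g⁻¹, A.inv_mem hg⟩
  rw [hP, Subgroup.mem_subgroupOf] at this
  simpa using this

namespace ImprimitiveDesign

section

open scoped Classical

variable {G Ω C 𝔅 : Type*} [Group G] [Fintype Ω] [Fintype C]
    [Fintype 𝔅] [MulAction G Ω] [MulAction G C] [MulAction G 𝔅] {cl : Ω → C}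
    {inc : Ω → 𝔅 → Prop} {lam v k c d ℓ : ℕ}

theorem false₁ [Finite G] (H : ImprimitiveDesign G cl inc 3 256 18 16 16 2) : False := by
  have : Fact (Nat.Prime 3) := ⟨Nat.prime_three⟩
  have N := H.counts₁
  have hK := H.kernel_trivial₁
  have h7 := H.not_seven_dvd_card
  have h2 := H.two_transitive N.through N.through_meeting (by simp) (by simp)
    (by intro n; omega)
  obtain ⟨T, hT, hTi⟩ : ∃ T : Subgroup G, IsPGroup 3 T ∧ ¬ 3 ∣ T.index := by
    obtain ⟨P⟩ : Nonempty (Sylow 3 G) := inferInstance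
    exact ⟨P, P.isPGroup', P.not_dvd_index⟩
  obtain ⟨B, hB⟩ : ∃ B : 𝔅, ∀ t ∈ T, t • B = B := by
    have h := card_modEq_card_fixed hT (Finset.univ : Finset 𝔅) (by simp)
    rw [Finset.card_univ, N.blocks] at h
    obtain ⟨B, hB⟩ : (Finset.univ.filter fun B : 𝔅 => ∀ t ∈ T, t • B = B).Nonempty := by
      rw [← Finset.card_pos]
      unfold Nat.ModEq at h
      omega
    exact ⟨B, by simpa using hB⟩
  obtain ⟨α, hα⟩ : ∃ α : Ω, ∀ t ∈ T, t • α = α := by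
    have h := card_modEq_card_fixed hT (Finset.univ : Finset Ω) (by simp)
    rw [Finset.card_univ, H.card_point] at h
    obtain ⟨α, hα⟩ : (Finset.univ.filter fun α : Ω => ∀ t ∈ T, t • α = α).Nonempty := by
      rw [← Finset.card_pos]
      unfold Nat.ModEq at h
      omega
    exact ⟨α, by simpa using hα⟩
  have hTA : T ≤ stabilizer G α := fun t ht => hα t ht
  have hAp : stabilizer G α ≤ stabilizer G (cl α) := by
    intro g hg
    rw [mem_stabilizer_iff] at hg ⊢
    rw [← H.cl_smul, hg]
  have hcardp : Nat.card (stabilizer G α) * 16 = Nat.card (stabilizer G (cl α)) := by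
    have h := card_inf_stabilizer_mul_card_orb (stabilizer G (cl α)) α
    have ho : orb (stabilizer G (cl α)) α = Finset.univ.filter fun β => cl β = cl α := by
      ext β
      simp only [mem_orb, Finset.mem_filter, Finset.mem_univ, true_and, mem_stabilizer_iff]
      constructor
      · rintro ⟨g, h, rfl⟩
        rw [H.cl_smul, h]
      · intro h
        obtain ⟨g, rfl⟩ := H.exists_smul_point N.through (by simp) α β
        exact ⟨g, by rwa [← H.cl_smul], rfl⟩
    rwa [ho, H.card_fiber, inf_eq_left.2 hAp] at h
  have h45 : 45 ∣ Nat.card (stabilizer G α) := by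
    obtain ⟨D, hD⟩ := H.exists_inc N.through (by simp) α
    have h := card_dvd_card_subgroup (stabilizer G α) (Finset.univ.filter fun B => inc α B) D ?_
    · rwa [N.through] at h
    · intro D'
      simp only [Finset.mem_filter, Finset.mem_univ, true_and, mem_stabilizer_iff]
      constructor
      · exact fun h => H.flag hD h
      · rintro ⟨g, hg, rfl⟩
        simpa [hg] using H.inc_smul g hD
  have hApos : 0 < Nat.card (stabilizer G α) := Nat.card_pos
  have hclass : ∀ {Δ Δ' : C}, Δ ≠ cl α → Δ' ≠ cl α → ∃ g : G, g • α = α ∧ g • Δ = Δ' :=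
    fun h h' => H.exists_smul_class N.through N.through_meeting (by intro n; omega) h h'
  have hST : ∀ Δ ∈ supp cl inc B, orb T Δ = supp cl inc B := by
    intro Δ hΔ
    have hsub : ∀ {K : Subgroup G}, K ≤ stabilizer G B → orb K Δ ⊆ supp cl inc B := by
      intro K hKB Δ' h
      obtain ⟨g, hg, rfl⟩ := mem_orb.1 h
      have hgB : g • B = B := hKB hg
      simpa [hgB] using (H.smul_mem_supp g).2 hΔ
    have ho : orb (stabilizer G B) Δ = supp cl inc B := by
      refine Finset.Subset.antisymm (hsub le_rfl) fun Δ' hΔ' => ?_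
      obtain ⟨β, hβ, rfl⟩ := mem_supp.1 hΔ
      obtain ⟨γ, hγ, rfl⟩ := mem_supp.1 hΔ'
      obtain ⟨g, h1, h2⟩ := H.flag hβ hγ
      exact mem_orb.2 ⟨g, h2, by rw [← H.cl_smul, h1]⟩
    have hTB : T ≤ stabilizer G B := fun t ht => hB t ht
    have hd := pow_dvd_card_orb (a := 2) Nat.prime_three hTB hTi (x := Δ)
      (by rw [ho, N.support]; simp)
    refine Finset.eq_of_subset_of_card_le (hsub hTB) ?_
    rw [N.support]
    exact Nat.le_of_dvd (Finset.card_pos.2 ⟨Δ, self_mem_orb T Δ⟩) hd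
  have h3 : ∀ Δ, Δ ≠ cl α → 3 ∣ (orb T Δ).card := by
    intro Δ hΔ
    have ho : orb (stabilizer G α) Δ = Finset.univ.erase (cl α) := by
      ext Δ'
      simp only [mem_orb, mem_stabilizer_iff, Finset.mem_erase, Finset.mem_univ, and_true]
      constructor
      · rintro ⟨g, hg, rfl⟩ h
        have hg' : g • cl α = cl α := by rw [← H.cl_smul, hg]
        rw [← hg'] at h
        exact hΔ (smul_left_cancel g h)
      · exact fun h => hclass hΔ h
    have hd := pow_dvd_card_orb (a := 1) Nat.prime_three hTA hTi (x := Δ) (by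
      rw [ho, Finset.card_erase_of_mem (Finset.mem_univ _), Finset.card_univ, H.card_class]
      simp)
    simpa using hd
  obtain ⟨q, F, Q, hq⟩ := exists_quad H.card_class h2 h7 hT hTi
    (fun t ht => hAp (hTA ht)) (N.support B) hST h3
  rcases Q.card_adj H.card_class h2 with hD | hD | hD
  · have := Q.card_stabilizer_le_of_card_eq_two H.card_class h2 hK hD
    omega
  · have hle := Q.card_stabilizer_le_of_card_eq_eight H.card_class h2 hK hD
    have hA : Nat.card (stabilizer G α) = 45 := by omega
    obtain ⟨x, hx⟩ : (supp cl inc B).Nonempty := by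
      rw [← Finset.card_pos, N.support]
      simp
    have hxp : x ≠ cl α := by
      rintro rfl
      have h := hST _ hx
      have : orb T (cl α) ⊆ {cl α} := by
        intro y hy
        obtain ⟨t, ht, rfl⟩ := mem_orb.1 hy
        exact Finset.mem_singleton.2 (hAp (hTA ht))
      have := Finset.card_le_card this
      rw [h, N.support] at this
      simp at this
    obtain ⟨g, hg, rfl⟩ := hclass Q.ne.symm hxp
    have hle' : (orb T (g • q)).card ≤ (orb T q).card := by
      rw [← Finset.card_image_of_injective (orb T q) (MulAction.injective g)]
      refine Finset.card_le_card fun y hy => ?_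
      obtain ⟨t, ht, rfl⟩ := mem_orb.1 hy
      refine Finset.mem_image.2 ⟨(g⁻¹ * t * g) • q, mem_orb.2 ⟨_, ?_, rfl⟩, ?_⟩
      · exact conj_mem_of_card_eq_forty_five hA hTA hT hTi hg ht
      · rw [← mul_smul, ← mul_smul]
        congr 1
        group
    rw [hq, hST _ hx, N.support] at hle'
    omega
  · exact h7 (Q.seven_dvd_card H.card_class h2 hD)

end

end ImprimitiveDesign

/-- The action of a permutation group on an invariant family of finite sets. -/
abbrev imageAction {Ω : Type*} [DecidableEq Ω] {G : Subgroup (Equiv.Perm Ω)}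
    {𝓢 : Finset (Finset Ω)} (h : ∀ g ∈ G, ∀ S ∈ 𝓢, S.image ⇑g ∈ 𝓢) : MulAction G {S // S ∈ 𝓢} where
  smul g S := ⟨S.1.image ⇑(g : Equiv.Perm Ω), h g g.2 S.1 S.2⟩
  one_smul S := Subtype.ext Finset.image_id
  mul_smul a b S := Subtype.ext (by
    change S.1.image ⇑((a : Equiv.Perm Ω) * b) =
      (S.1.image ⇑(b : Equiv.Perm Ω)).image ⇑(a : Equiv.Perm Ω)
    rw [Finset.image_image, Equiv.Perm.coe_mul])

end FlagTransitive

theorem stmt_19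
    {Ω : Type*} [Fintype Ω] [DecidableEq Ω]
    (v k lam c d ℓ : ℕ)
    (𝓑 𝓒 : Finset (Finset Ω))
    (G : Subgroup (Equiv.Perm Ω))
    (hv : Fintype.card Ω = v)
    (hlam1 : 1 ≤ lam)
    (hkcard : ∀ B ∈ 𝓑, B.card = k)
    (hpairs : ∀ α β : Ω, α ≠ β → (𝓑.filter (fun B => α ∈ B ∧ β ∈ B)).card = lam)
    (hk2 : 2 < k) (hkv : k < v)
    (hGB : ∀ g ∈ G, ∀ B ∈ 𝓑, B.image ⇑g ∈ 𝓑)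
    (hflag : ∀ B₁ ∈ 𝓑, ∀ B₂ ∈ 𝓑, ∀ α₁ ∈ B₁, ∀ α₂ ∈ B₂,
        ∃ g ∈ G, B₁.image ⇑g = B₂ ∧ g α₁ = α₂)
    (hpart : ∀ ω : Ω, ∃! Δ, Δ ∈ 𝓒 ∧ ω ∈ Δ)
    (hdcard : 𝓒.card = d) (hd2 : 2 ≤ d)
    (hccard : ∀ Δ ∈ 𝓒, Δ.card = c) (hc2 : 2 ≤ c)
    (hGC : ∀ g ∈ G, ∀ Δ ∈ 𝓒, Δ.image ⇑g ∈ 𝓒)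
    (hl2 : 2 ≤ ℓ)
    (hlcap : ∀ B ∈ 𝓑, ∀ Δ ∈ 𝓒, (B ∩ Δ).Nonempty → (B ∩ Δ).card = ℓ)
    (htuple : (lam, v, k, c, d, ℓ) = (3, 256, 18, 16, 16, 2) ∨
      (lam, v, k, c, d, ℓ) = (4, 231, 24, 21, 11, 3) ∨
      (lam, v, k, c, d, ℓ) = (4, 484, 24, 22, 22, 2))
    : False := by
  let := FlagTransitive.imageAction hGB
  let := FlagTransitive.imageAction hGC
  choose cl hcl hcl_unique using hpart
  let cl' : Ω → {Δ // Δ ∈ 𝓒} := fun ω => ⟨cl ω, (hcl ω).1⟩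
  let inc : Ω → {B // B ∈ 𝓑} → Prop := fun ω B => ω ∈ B.1
  have hcl' : ∀ (ω : Ω) (Δ : {Δ // Δ ∈ 𝓒}), cl' ω = Δ ↔ ω ∈ Δ.1 := fun ω Δ =>
    ⟨fun h => h ▸ (hcl ω).2, fun h => Subtype.ext (hcl_unique ω Δ.1 ⟨Δ.2, h⟩).symm⟩
  have H : FlagTransitive.ImprimitiveDesign G cl' inc lam v k c d ℓ :=
    { cl_smul := fun g α => (hcl' _ _).2 (Finset.mem_image_of_mem _ (hcl α).2)
      inc_smul := fun g _ _ h => Finset.mem_image_of_mem _ h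
      faithful := fun g h => Subtype.ext (Equiv.ext h)
      flag := by
        intro α β B D hB hD
        obtain ⟨g, hg, h1, h2⟩ := hflag B.1 B.2 D.1 D.2 α hB β hD
        exact ⟨⟨g, hg⟩, h2, Subtype.ext h1⟩
      card_point := hv
      card_class := by rw [Fintype.card_coe, hdcard]
      card_fiber := by
        intro Δ
        rw [← hccard Δ.1 Δ.2]
        congr 1
        ext α
        simp [hcl']
      card_block := by
        intro B
        rw [← hkcard B.1 B.2]
        congr 1
        ext α
        simp [inc]
      card_pair := by
        intro α β h
        rw [← hpairs α β h]
        refine Finset.card_bij (fun B _ => B.1) (fun B hB => ?_) (fun B _ D _ h => Subtype.ext h)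
          (fun B hB => ?_)
        · simpa [inc] using hB
        · rw [Finset.mem_filter] at hB
          exact ⟨⟨B, hB.1⟩, by simpa [inc] using hB.2, rfl⟩
      card_inter := by
        intro α B h
        rw [← hlcap B.1 B.2 (cl α) (hcl α).1 ⟨α, Finset.mem_inter.2 ⟨h, (hcl α).2⟩⟩]
        congr 1
        ext β
        simp [hcl', inc, cl'] }
  simp only [Prod.mk.injEq] at htuple
  rcases htuple with ⟨rfl, rfl, rfl, rfl, rfl, rfl⟩ | ⟨rfl, rfl, rfl, rfl, rfl, rfl⟩ |
    ⟨rfl, rfl, rfl, rfl, rfl, rfl⟩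
  · exact H.false₁
  · exact H.false₂
  · exact H.false₃
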